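/- arXiv:2210.09344 — 4 statements merged into one kernel-verified Lean document; each statement's English description precedes it below -/
import Mathlib

section
/- Let R be a commutative Noetherian ring, A a projective Noetherian R-algebra, and Q a finitely generated A-module projective over R with Ext_A^{i>0}(Q,Q)=0 and DQ ⊗_A Q projective over R. Let M be a finitely generated A-module projective over R with an (A,R)-exact sequence 0 → M → Q_1 → ... → Q_t → X → 0 where Q_i ∈ add Q. If Ext_A^i(X, Q) = 0 for 1 ≤ i ≤ t, then Q-domdim_{(A,R)} M = t + Q-domdim_{(A,R)} X. -/
universe u
open Function TensorProduct

namespace RelDom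

section


variable (R : Type u) [CommRing R] (A : Type u) [Ring A] [Algebra R A]

/-- `M` is a direct summand of a finite direct sum of copies of `T`, i.e. `M ∈ add T`. -/
def InAdd (T : Type u) [AddCommGroup T] [Module A T]
    (M : Type u) [AddCommGroup M] [Module A M] : Prop :=
  ∃ (n : ℕ) (i : M →ₗ[A] (Fin n → T)) (p : (Fin n → T) →ₗ[A] M), ∀ m, p (i m) = m

/-- `f` is an `(A,R)`-monomorphism : an injective `A`-linear map admitting an
`R`-linear retraction (the `R`-action being the one through `algebraMap R A`). -/
def RSplitMono {M N : Type u} [AddCommGroup M] [Module A M]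
    [AddCommGroup N] [Module A N] (f : M →ₗ[A] N) : Prop :=
  Injective f ∧ ∃ r : N →+ M,
    (∀ (s : R) (x : N), r (algebraMap R A s • x) = algebraMap R A s • r x) ∧
    ∀ m, r (f m) = m

/-- `f` is an `(A,R)`-epimorphism : a surjective `A`-linear map admitting an
`R`-linear section. -/
def RSplitEpi {M N : Type u} [AddCommGroup M] [Module A M]
    [AddCommGroup N] [Module A N] (f : M →ₗ[A] N) : Prop :=
  Surjective f ∧ ∃ s : N →+ M,
    (∀ (c : R) (x : N), s (algebraMap R A c • x) = algebraMap R A c • s x) ∧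
    ∀ x, f (s x) = x

/-- A submodule `p ≤ N` is an `R`-direct summand of `N`. -/
def RSummand {N : Type u} [AddCommGroup N] [Module A N] (p : Submodule A N) : Prop :=
  ∃ r : N →+ p, (∀ (c : R) (x : N), r (algebraMap R A c • x) = algebraMap R A c • r x) ∧
    ∀ x : p, r x = x

/-- `Q`-relative dominant dimension of `M` is at least `n`:
there is an `(A,R)`-exact sequence `0 → M → T₁ → ⋯ → Tₙ` with all `Tᵢ ∈ add Q`
which stays exact under `Hom_A(-, Q)`. -/
def DomdimGE (Q : Type u) [AddCommGroup Q] [Module A Q] :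
    ℕ → ModuleCat.{u} A → Prop
  | 0, _ => True
  | n + 1, M =>
      ∃ (T : ModuleCat.{u} A) (_ : InAdd A Q T) (f : M →ₗ[A] T),
        RSplitMono R A f ∧
        (∀ g : (M : Type u) →ₗ[A] Q, ∃ h : (T : Type u) →ₗ[A] Q, ∀ m, h (f m) = g m) ∧
        DomdimGE Q n (ModuleCat.of A ((T : Type u) ⧸ LinearMap.range f))

/-- `Q`-relative codominant dimension of `M` is at least `n`. -/
def CodomdimGE (Q : Type u) [AddCommGroup Q] [Module A Q] :
    ℕ → ModuleCat.{u} A → Prop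
  | 0, _ => True
  | n + 1, M =>
      ∃ (T : ModuleCat.{u} A) (_ : InAdd A Q T) (f : T →ₗ[A] M),
        RSplitEpi R A f ∧
        (∀ g : Q →ₗ[A] (M : Type u), ∃ h : Q →ₗ[A] (T : Type u), ∀ q, f (h q) = g q) ∧
        CodomdimGE Q n (ModuleCat.of A (LinearMap.ker f))

/-- The relative dominant dimension of `M` with respect to `Q`, as a value in `ℕ∞`. -/
noncomputable def Domdim (Q : Type u) [AddCommGroup Q] [Module A Q]
    (M : ModuleCat.{u} A) : ℕ∞ :=
  ⨆ (n : ℕ) (_ : DomdimGE R A Q n M), (n : ℕ∞)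

/-- The relative codominant dimension of `M` with respect to `Q`, as a value in `ℕ∞`. -/
noncomputable def Codomdim (Q : Type u) [AddCommGroup Q] [Module A Q]
    (M : ModuleCat.{u} A) : ℕ∞ :=
  ⨆ (n : ℕ) (_ : CodomdimGE R A Q n M), (n : ℕ∞)


end

section


variable (R : Type u) [CommRing R] (A : Type u) [Ring A] [Algebra R A]

section Dual

variable (S : Type u) [Ring S]
variable (M : Type u) [AddCommGroup M] [Module R M] [Module S M] [SMulCommClass S R M]

/-- scalar action of `a : S` as an `R`-linear endomorphism. -/
def smulEnd (a : S) : M →ₗ[R] M where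
  toFun m := a • m
  map_add' := smul_add a
  map_smul' r m := smul_comm a r m

/-- The standard duality `D = Hom_R(-, R)` turns a left `S`-module into a right
`S`-module, i.e. a module over `Sᵐᵒᵖ`. -/
instance dualModule : Module Sᵐᵒᵖ (M →ₗ[R] R) where
  smul a f := f ∘ₗ smulEnd R S M a.unop
  one_smul f := LinearMap.ext fun m => by
    show f ((1 : Sᵐᵒᵖ).unop • m) = f m
    simp
  mul_smul a b f := LinearMap.ext fun m => by
    show f ((a * b).unop • m) = f (b.unop • a.unop • m)
    rw [MulOpposite.unop_mul, mul_smul]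
  smul_zero a := LinearMap.ext fun m => rfl
  smul_add a f g := LinearMap.ext fun m => rfl
  add_smul a b f := LinearMap.ext fun m => by
    show f ((a + b).unop • m) = f (a.unop • m) + f (b.unop • m)
    rw [MulOpposite.unop_add, add_smul, map_add]
  zero_smul f := LinearMap.ext fun m => by
    show f ((0 : Sᵐᵒᵖ).unop • m) = 0
    rw [MulOpposite.unop_zero, zero_smul, map_zero]

lemma dual_smul_apply (a : Sᵐᵒᵖ) (f : M →ₗ[R] R) (m : M) :
    (a • f) m = f (a.unop • m) := rfl

end Dual

section Coind

/-- The left `A`-module structure on `Hom_R(A, R)`, the dual of the *right*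
regular module: `(a • f) x = f (x * a)`. -/
instance coindModule : Module A (A →ₗ[R] R) where
  smul a f := f ∘ₗ
    { toFun := fun x => x * a
      map_add' := fun x y => add_mul x y a
      map_smul' := fun r x => smul_mul_assoc r x a }
  one_smul f := LinearMap.ext fun x => by
    show f (x * 1) = f x
    rw [mul_one]
  mul_smul a b f := LinearMap.ext fun x => by
    show f (x * (a * b)) = f ((x * a) * b)
    rw [mul_assoc]
  smul_zero a := LinearMap.ext fun x => rfl
  smul_add a f g := LinearMap.ext fun x => rfl
  add_smul a b f := LinearMap.ext fun x => by
    show f (x * (a + b)) = f (x * a) + f (x * b)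
    rw [mul_add, map_add]
  zero_smul f := LinearMap.ext fun x => by
    show f (x * 0) = 0
    rw [mul_zero, map_zero]

lemma coind_smul_apply (a : A) (f : A →ₗ[R] R) (x : A) :
    (a • f) x = f (x * a) := rfl

end Coind

section TensorOver

variable (X : Type u) [AddCommGroup X] [Module R X] [Module Aᵐᵒᵖ X]
variable (Y : Type u) [AddCommGroup Y] [Module R Y] [Module A Y]

/-- The balancing relations for the tensor product over the (possibly
noncommutative) `R`-algebra `A`. -/
def balanceRel : Set (X ⊗[R] Y) :=
  {z | ∃ (x : X) (a : A) (y : Y),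
    z = (MulOpposite.op a • x) ⊗ₜ[R] y - x ⊗ₜ[R] (a • y)}

/-- The tensor product `X ⊗_A Y` of a right `A`-module `X` and a left `A`-module `Y`
over the `R`-algebra `A`, realized as a quotient of `X ⊗[R] Y`. -/
abbrev TensorOver : Type u :=
  (X ⊗[R] Y) ⧸ Submodule.span R (balanceRel R A X Y)

end TensorOver


end

section


variable (R : Type u) [CommRing R] (A : Type u) [Ring A] [Algebra R A]

section Counit

variable (Q : Type u) [AddCommGroup Q] [Module R Q] [Module A Q]
variable (M : Type u) [AddCommGroup M] [Module R M] [Module A M]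
variable [SMulCommClass A R M] [SMulCommClass R A Q] [IsScalarTower R A Q] [IsScalarTower R A M]
variable [SMulCommClass R A M]

/-- `Hom_A(Q, M)` is a right module over `E := End_A(Q)`, i.e. a left module over
`Eᵐᵒᵖ = End_A(Q)ᵐᵒᵖ`, by precomposition.  Note that `End_A(Q)ᵐᵒᵖ` is exactly the
algebra `B = End_A(Q)ᵒᵖ` and `Hom_A(Q,M)` is the usual left `B`-module `F_Q M`. -/
instance homEndModule : Module (Module.End A Q)ᵐᵒᵖ (Q →ₗ[A] M) where
  smul b g := g ∘ₗ b.unop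
  one_smul g := LinearMap.ext fun q => rfl
  mul_smul a b g := LinearMap.ext fun q => rfl
  smul_zero b := LinearMap.ext fun q => rfl
  smul_add b f g := LinearMap.ext fun q => rfl
  add_smul a b g := LinearMap.ext fun q => by
    show g ((a + b).unop q) = g (a.unop q) + g (b.unop q)
    rw [MulOpposite.unop_add, LinearMap.add_apply, map_add]
  zero_smul g := LinearMap.ext fun q => by
    show g ((0 : (Module.End A Q)ᵐᵒᵖ).unop q) = 0
    rw [MulOpposite.unop_zero, LinearMap.zero_apply, map_zero]

lemma homEnd_smul_apply (b : (Module.End A Q)ᵐᵒᵖ) (g : Q →ₗ[A] M) (q : Q) :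
    (b • g) q = g (b.unop q) := rfl

/-- The balancing relations for `Q ⊗_B Hom_A(Q, M)`, where `B = End_A(Q)ᵒᵖ`. -/
def counitRel : Set (Q ⊗[R] (Q →ₗ[A] M)) :=
  {z | ∃ (q : Q) (b : Module.End A Q) (g : Q →ₗ[A] M),
    z = (b q) ⊗ₜ[R] g - q ⊗ₜ[R] (g ∘ₗ b)}

/-- `Q ⊗_B Hom_A(Q, M)`, where `B = End_A(Q)ᵒᵖ`, as a left `A`-module. -/
abbrev CounitDom : Type u :=
  (Q ⊗[R] (Q →ₗ[A] M)) ⧸ Submodule.span A (counitRel R A Q M)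

/-- evaluation, `A`-linearly in the first variable -/
noncomputable def evalHom : Q →ₗ[A] ((Q →ₗ[A] M) →ₗ[R] M) where
  toFun q :=
    { toFun := fun g => g q
      map_add' := fun g h => rfl
      map_smul' := fun r g => rfl }
  map_add' q q' := LinearMap.ext fun g => g.map_add q q'
  map_smul' a q := LinearMap.ext fun g => g.map_smul a q

noncomputable def counitAux : (Q ⊗[R] (Q →ₗ[A] M)) →ₗ[A] M :=
  TensorProduct.AlgebraTensorModule.lift (evalHom R A Q M)

/-- The counit `χ_M : Q ⊗_B Hom_A(Q, M) → M`, `q ⊗ g ↦ g q`. -/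
noncomputable def counit : CounitDom R A Q M →ₗ[A] M :=
  Submodule.liftQ _ (counitAux R A Q M) (by
    rw [Submodule.span_le]
    rintro z ⟨q, b, g, rfl⟩
    simp [counitAux, evalHom, SetLike.mem_coe, LinearMap.mem_ker])

end Counit

section Tor

variable (S : Type u) [Ring S]
variable (X : Type u) [AddCommGroup X] [Module Sᵐᵒᵖ X]

/-- The map obtained from an `S`-linear map between finite free left `S`-modules
by tensoring with the right `S`-module `X` (under `X ⊗_S S^m ≅ X^m`). -/
noncomputable def piMap {m n : ℕ} (d : (Fin m → S) →ₗ[S] (Fin n → S)) (v : Fin m → X) :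
    Fin n → X :=
  fun i => ∑ j, MulOpposite.op (d (Pi.single j 1) i) • v j

variable (Y : Type u) [AddCommGroup Y] [Module S Y]

/-- `Tor_i^S(X, Y) = 0` for all `1 ≤ i ≤ q`, expressed via a resolution of `Y` by
finite free left `S`-modules, tensored over `S` with the right `S`-module `X`. -/
noncomputable def TorVanishUpTo (q : ℕ) : Prop :=
  ∃ (k : ℕ → ℕ) (d : ∀ n, (Fin (k (n+1)) → S) →ₗ[S] (Fin (k n) → S))
    (ε : (Fin (k 0) → S) →ₗ[S] Y),
    Surjective ε ∧ LinearMap.ker ε = LinearMap.range (d 0) ∧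
    (∀ n, LinearMap.ker (d n) = LinearMap.range (d (n+1))) ∧
    ∀ i, i + 1 ≤ q → ∀ v : Fin (k (i+1)) → X, piMap S X (d i) v = 0 →
      ∃ w : Fin (k (i+2)) → X, piMap S X (d (i+1)) w = v

end Tor

section Ext

open CategoryTheory

/-- Vanishing of `Ext_A^i(X, Y)`. -/
def ExtVanish (X Y : ModuleCat.{u} A) (i : ℕ) : Prop :=
  Subsingleton ((((_root_.Ext ℤ (ModuleCat.{u} A) i).obj (Opposite.op X)).obj Y : Type u))

end Ext

section InjDim

/-- `M` admits a finite injective coresolution of length `≤ d`, i.e. the injective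
dimension of `M` is at most `d`. -/
def InjCoresLE : ℕ → ModuleCat.{u} A → Prop
  | 0, M => Module.Injective A M
  | d + 1, M => ∃ (I : ModuleCat.{u} A) (f : M →ₗ[A] I),
      Module.Injective A I ∧ Injective f ∧
      InjCoresLE d (ModuleCat.of A ((I : Type u) ⧸ LinearMap.range f))

end InjDim


end

end RelDom

namespace RelDom

section Helpers

variable {R : Type u} [CommRing R] {A : Type u} [Ring A] [Algebra R A]
variable {Q : Type u} [AddCommGroup Q] [Module A Q]

lemma inAdd_iff_families {M : Type u} [AddCommGroup M] [Module A M] :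
    InAdd A Q M ↔ ∃ (n : ℕ) (a : Fin n → (M →ₗ[A] Q)) (b : Fin n → (Q →ₗ[A] M)),
      ∀ m, ∑ j, b j (a j m) = m := by
  constructor
  · rintro ⟨n, i, p, h⟩
    refine ⟨n, fun j => (LinearMap.proj j).comp i, fun j => p.comp (LinearMap.single A (fun _ => Q) j), ?_⟩
    intro m
    conv_rhs => rw [← h m]
    simp only [LinearMap.comp_apply, LinearMap.proj_apply]
    rw [← map_sum]
    congr 1
    exact Finset.univ_sum_single (i m)
  · rintro ⟨n, a, b, h⟩
    refine ⟨n, LinearMap.pi a, ∑ j, (b j).comp (LinearMap.proj j), ?_⟩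
    intro m
    simpa using h m

lemma inAdd_of_families {M : Type u} [AddCommGroup M] [Module A M] {ι : Type} [Fintype ι]
    (a : ι → (M →ₗ[A] Q)) (b : ι → (Q →ₗ[A] M)) (h : ∀ m, ∑ j, b j (a j m) = m) :
    InAdd A Q M := by
  rw [inAdd_iff_families]
  let e := Fintype.equivFin ι
  refine ⟨Fintype.card ι, fun j => a (e.symm j), fun j => b (e.symm j), fun m => ?_⟩
  conv_rhs => rw [← h m]
  exact Equiv.sum_comp e.symm (fun j => b j (a j m))

lemma inAdd_prod {M N : Type u} [AddCommGroup M] [Module A M] [AddCommGroup N] [Module A N]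
    (hM : InAdd A Q M) (hN : InAdd A Q N) : InAdd A Q (M × N) := by
  rw [inAdd_iff_families] at hM hN
  obtain ⟨n, a, b, h⟩ := hM
  obtain ⟨n', a', b', h'⟩ := hN
  refine inAdd_of_families (ι := Fin n ⊕ Fin n')
    (Sum.elim (fun j => (a j).comp (LinearMap.fst A M N)) (fun j => (a' j).comp (LinearMap.snd A M N)))
    (Sum.elim (fun j => (LinearMap.inl A M N).comp (b j))
      (fun j => (LinearMap.inr A M N).comp (b' j))) ?_
  rintro ⟨m, n⟩
  simp only [Fintype.sum_sum_type, Sum.elim_inl, Sum.elim_inr, LinearMap.comp_apply,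
    LinearMap.fst_apply, LinearMap.snd_apply]
  rw [← map_sum, ← map_sum, h, h']
  simp

/-- extension of maps into `Q` gives extension of maps into `add Q` -/
lemma extend_inAdd {M N T : Type u} [AddCommGroup M] [Module A M] [AddCommGroup N] [Module A N]
    [AddCommGroup T] [Module A T] (hT : InAdd A Q T) (f : M →ₗ[A] N)
    (hf : ∀ g : M →ₗ[A] Q, ∃ h : N →ₗ[A] Q, ∀ m, h (f m) = g m) (g : M →ₗ[A] T) :
    ∃ h : N →ₗ[A] T, ∀ m, h (f m) = g m := by
  rw [inAdd_iff_families] at hT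
  obtain ⟨n, a, b, hab⟩ := hT
  choose h hh using fun j => hf ((a j).comp g)
  refine ⟨∑ j, (b j).comp (h j), fun m => ?_⟩
  simp only [LinearMap.sum_apply, LinearMap.comp_apply, hh]
  exact hab _

lemma equiv_of_ker_eq {P X Y : Type u} [AddCommGroup P] [Module A P] [AddCommGroup X] [Module A X]
    [AddCommGroup Y] [Module A Y] (p : P →ₗ[A] X) (q : P →ₗ[A] Y) (hp : Surjective p)
    (hq : Surjective q) (h : LinearMap.ker p = LinearMap.ker q) : Nonempty (X ≃ₗ[A] Y) :=
  ⟨(p.quotKerEquivOfSurjective hp).symm.trans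
    ((Submodule.quotEquivOfEq _ _ h).trans (q.quotKerEquivOfSurjective hq))⟩

lemma domdimGE_iso (n : ℕ) {M M' : ModuleCat.{u} A} (e : (M : Type u) ≃ₗ[A] (M' : Type u))
    (h : DomdimGE R A Q n M) : DomdimGE R A Q n M' := by
  induction n generalizing M M' with
  | zero => trivial
  | succ n ih =>
    obtain ⟨T, hT, f, ⟨hinj, r, hr, hrf⟩, hf, hc⟩ := h
    refine ⟨T, hT, f.comp e.symm.toLinearMap, ⟨hinj.comp e.symm.injective,
      e.toLinearMap.toAddMonoidHom.comp r, ?_, ?_⟩, ?_, ?_⟩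
    · intro s x
      simp [hr]
    · intro m
      simp [hrf]
    · intro g
      obtain ⟨k, hk⟩ := hf (g.comp e.toLinearMap)
      exact ⟨k, fun m => by simp [hk]⟩
    · refine ih (Submodule.quotEquivOfEq _ _ ?_) hc
      rw [LinearMap.range_comp_of_range_eq_top _ e.symm.range]

lemma domdimGE_prod (n : ℕ) {L T : ModuleCat.{u} A} (hT : InAdd A Q T)
    (h : DomdimGE R A Q n L) :
    DomdimGE R A Q n (ModuleCat.of A (Prod L T)) := by
  cases n with
  | zero => trivial
  | succ n =>
    obtain ⟨T₁, hT₁, f, ⟨hinj, r, hr, hrf⟩, hf, hc⟩ := h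
    refine ⟨ModuleCat.of A (Prod T₁ T), inAdd_prod hT₁ hT,
      f.prodMap LinearMap.id, ⟨?_, r.prodMap (AddMonoidHom.id _), ?_, ?_⟩, ?_, ?_⟩
    · exact Prod.map_injective.2 ⟨hinj, injective_id⟩
    · rintro s ⟨x, y⟩
      exact Prod.ext (hr s x) rfl
    · rintro ⟨x, y⟩
      exact Prod.ext (hrf x) rfl
    · intro g
      obtain ⟨k, hk⟩ := hf (g.comp (LinearMap.inl A _ _))
      refine ⟨LinearMap.coprod k (g.comp (LinearMap.inr A _ _)), ?_⟩
      rintro ⟨x, y⟩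
      change k (f x) + g (0, y) = g (x, y)
      rw [hk]
      change g (x, 0) + g (0, y) = g (x, y)
      rw [← map_add]
      simp
    · obtain ⟨e⟩ := equiv_of_ker_eq
        ((LinearMap.range f).mkQ.comp (LinearMap.fst A (T₁ : Type u) (T : Type u)))
        (LinearMap.range (f.prodMap (LinearMap.id : (T : Type u) →ₗ[A] T))).mkQ
        ((Submodule.mkQ_surjective _).comp Prod.fst_surjective)
        (Submodule.mkQ_surjective _) (by
          ext ⟨x, y⟩
          simp)
      exact domdimGE_iso n e hc

lemma domdimGE_of_prod (n : ℕ) {L T : ModuleCat.{u} A} (hT : InAdd A Q T)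
    (h : DomdimGE R A Q n (ModuleCat.of A (Prod L T))) :
    DomdimGE R A Q n L := by
  cases n with
  | zero => trivial
  | succ n =>
    obtain ⟨T₁, hT₁, f, ⟨hinj, r, hr, hrf⟩, hf, hc⟩ := h
    change (Prod L T) →ₗ[A] T₁ at f
    obtain ⟨ρ, hρ⟩ := extend_inAdd hT f hf (LinearMap.snd A (L : Type u) (T : Type u))
    refine ⟨T₁, hT₁, f.comp (LinearMap.inl A _ _), ⟨hinj.comp LinearMap.inl_injective,
      (AddMonoidHom.fst (L : Type u) (T : Type u)).comp r, ?_, ?_⟩, ?_, ?_⟩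
    · intro s x
      exact congrArg Prod.fst (hr s x)
    · intro m
      exact congrArg Prod.fst (hrf (m, 0))
    · intro g
      obtain ⟨k, hk⟩ := hf (g.comp (LinearMap.fst A _ _))
      exact ⟨k, fun m => hk (m, 0)⟩
    · obtain ⟨e⟩ := equiv_of_ker_eq
        ((LinearMap.range f).mkQ.prod ρ)
        (LinearMap.range (f.comp (LinearMap.inl A (L : Type u) (T : Type u)))).mkQ
        (by
          rintro ⟨x, t⟩
          obtain ⟨x, rfl⟩ := Submodule.mkQ_surjective _ x
          refine ⟨x + f (0, t - ρ x), Prod.ext ?_ ?_⟩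
          · change (LinearMap.range f).mkQ _ = (LinearMap.range f).mkQ _
            rw [map_add, add_eq_left]
            simp
          · change ρ _ = t
            rw [map_add, hρ]
            simp)
        (Submodule.mkQ_surjective _) (by
          ext x
          simp only [LinearMap.ker_prod, Submodule.mem_inf, Submodule.ker_mkQ, LinearMap.mem_ker,
            LinearMap.mem_range, LinearMap.comp_apply, LinearMap.inl_apply]
          constructor
          · rintro ⟨⟨⟨l, t⟩, rfl⟩, h0⟩
            rw [hρ] at h0
            change t = 0 at h0
            subst h0
            exact ⟨l, rfl⟩
          · rintro ⟨l, rfl⟩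
            exact ⟨⟨_, rfl⟩, hρ _⟩)
      exact domdimGE_iso n e (domdimGE_prod n hT hc)

/-- The key step. -/
lemma domdimGE_succ_iff (n : ℕ) {K T K' : ModuleCat.{u} A} (hT : InAdd A Q T)
    (f : (K : Type u) →ₗ[A] (T : Type u)) (g : (T : Type u) →ₗ[A] (K' : Type u))
    (hfs : RSplitMono R A f) (hg : Surjective g) (hfg : LinearMap.ker g = LinearMap.range f)
    (hf : ∀ k : (K : Type u) →ₗ[A] Q, ∃ h : (T : Type u) →ₗ[A] Q, ∀ m, h (f m) = k m) :
    DomdimGE R A Q (n + 1) K ↔ DomdimGE R A Q n K' := by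
  constructor
  · rintro ⟨T', hT', f', -, hf', hc⟩
    obtain ⟨a, ha⟩ := extend_inAdd hT' f hf f'
    obtain ⟨b, hb⟩ := extend_inAdd hT f' hf' f
    have hgf : ∀ k, g (f k) = 0 := fun k => by
      have : f k ∈ LinearMap.ker g := hfg ▸ ⟨k, rfl⟩
      exact this
    obtain ⟨e⟩ := equiv_of_ker_eq (P := Prod T T')
      (((LinearMap.range f').mkQ.comp (LinearMap.snd A _ _)).prod
        (LinearMap.fst A (T : Type u) (T' : Type u) + b.comp (LinearMap.snd A _ _)))
      ((g.comp (LinearMap.fst A _ _)).prod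
        (LinearMap.snd A (T : Type u) (T' : Type u) + a.comp (LinearMap.fst A _ _)))
      (by
        rintro ⟨y, x⟩
        obtain ⟨y, rfl⟩ := Submodule.mkQ_surjective _ y
        exact ⟨(x - b y, y), by simp⟩)
      (by
        rintro ⟨x, y⟩
        obtain ⟨x, rfl⟩ := hg x
        exact ⟨(x, y - a x), by simp⟩)
      (by
        ext ⟨x, y⟩
        simp only [LinearMap.ker_prod, Submodule.mem_inf, LinearMap.mem_ker, LinearMap.comp_apply,
          LinearMap.fst_apply, LinearMap.snd_apply, LinearMap.add_apply, Submodule.mkQ_apply,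
          Submodule.Quotient.mk_eq_zero, LinearMap.mem_range]
        constructor
        · rintro ⟨⟨k, rfl⟩, h⟩
          rw [hb] at h
          obtain rfl := eq_neg_of_add_eq_zero_left h
          simp [hgf, ha]
        · rintro ⟨h1, h⟩
          have : x ∈ LinearMap.range f := hfg ▸ h1
          obtain ⟨k, rfl⟩ := this
          rw [ha] at h
          obtain rfl := eq_neg_of_add_eq_zero_left h
          exact ⟨⟨-k, by simp⟩, by simp [hb]⟩)
    exact domdimGE_of_prod n hT' (domdimGE_iso (M' := ModuleCat.of A (Prod K' T'))
      n e (domdimGE_prod n hT hc))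
  · intro h
    refine ⟨T, hT, f, hfs, hf, ?_⟩
    obtain ⟨e⟩ := equiv_of_ker_eq g (LinearMap.range f).mkQ hg (Submodule.mkQ_surjective _)
      (by rw [hfg, Submodule.ker_mkQ])
    exact domdimGE_iso n e h

open CategoryTheory

lemma ext_of_vanish {X Y : ModuleCat.{u} A} (i : ℕ) (h : ExtVanish A X Y (i + 1)) :
    Subsingleton (Abelian.Ext.{u} X Y (i + 1)) := by
  let P := projectiveResolution X
  refine subsingleton_of_forall_eq 0 fun α => ?_
  obtain ⟨f, hf, rfl⟩ := P.extMk_surjective α (i + 2) rfl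
  rw [P.extMk_eq_zero_iff f (i + 2) rfl hf i rfl]
  have hz : Limits.IsZero ((P.complex.linearYonedaObj ℤ Y).homology (i + 1)) := by
    refine Limits.IsZero.of_iso ?_ (P.isoExt (R := ℤ) (i + 1) Y).symm
    have := h
    unfold ExtVanish at this
    exact ModuleCat.isZero_of_subsingleton _
  rw [← HomologicalComplex.exactAt_iff_isZero_homology,
    HomologicalComplex.exactAt_iff' _ i (i + 1) (i + 2) (by simp) (by simp),
    ShortComplex.moduleCat_exact_iff] at hz
  obtain ⟨g, hg⟩ := hz f hf
  exact ⟨g, hg⟩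

lemma ext_inAdd {T : ModuleCat.{u} A} {Y : ModuleCat.{u} A} (hT : InAdd A Q T) (i : ℕ)
    (h : Subsingleton (Abelian.Ext.{u} (ModuleCat.of A Q) Y i)) :
    Subsingleton (Abelian.Ext.{u} T Y i) := by
  rw [inAdd_iff_families] at hT
  obtain ⟨n, a, b, hab⟩ := hT
  refine subsingleton_of_forall_eq 0 fun e => ?_
  have hid : 𝟙 T = ∑ j, (ModuleCat.ofHom (a j) : T ⟶ ModuleCat.of A Q) ≫
      (ModuleCat.ofHom (b j) : ModuleCat.of A Q ⟶ T) := by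
    ext m
    simp [hab]
  rw [← Abelian.Ext.mk₀_id_comp e, hid, Abelian.Ext.mk₀_sum, Abelian.Ext.sum_comp]
  refine Finset.sum_eq_zero fun j _ => ?_
  rw [← Abelian.Ext.mk₀_comp_mk₀, Abelian.Ext.comp_assoc_of_second_deg_zero,
    Subsingleton.elim ((Abelian.Ext.mk₀ _).comp e _) 0, Abelian.Ext.comp_zero]

lemma ext_shift {K T K' Y : ModuleCat.{u} A}
    (f : (K : Type u) →ₗ[A] (T : Type u)) (g : (T : Type u) →ₗ[A] (K' : Type u))
    (hfi : Injective f) (hg : Surjective g) (hfg : LinearMap.ker g = LinearMap.range f) (i : ℕ)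
    (h : Subsingleton (Abelian.Ext.{u} K' Y (i + 1))) (x : Abelian.Ext.{u} K Y i) :
    ∃ y : Abelian.Ext.{u} T Y i,
      (Abelian.Ext.mk₀ (ModuleCat.ofHom f)).comp y (zero_add i) = x := by
  have hw : ModuleCat.ofHom f ≫ ModuleCat.ofHom g = 0 := by
    ext k
    have : f k ∈ LinearMap.ker g := hfg ▸ ⟨k, rfl⟩
    exact this
  let S : ShortComplex (ModuleCat.{u} A) := ShortComplex.mk (ModuleCat.ofHom f) (ModuleCat.ofHom g) hw
  have hS : S.ShortExact :=
    { exact := by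
        rw [ShortComplex.moduleCat_exact_iff_range_eq_ker]
        exact hfg.symm
      mono_f := (ModuleCat.mono_iff_injective _).2 hfi
      epi_g := (ModuleCat.epi_iff_surjective _).2 hg }
  exact Abelian.Ext.contravariant_sequence_exact₁ hS Y x (add_comm 1 i) (Subsingleton.elim _ _)

lemma extend_of_ext {K T K' : ModuleCat.{u} A}
    (f : (K : Type u) →ₗ[A] (T : Type u)) (g : (T : Type u) →ₗ[A] (K' : Type u))
    (hfi : Injective f) (hg : Surjective g) (hfg : LinearMap.ker g = LinearMap.range f)
    (h : Subsingleton (Abelian.Ext.{u} K' (ModuleCat.of A Q) 1))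
    (k : (K : Type u) →ₗ[A] Q) : ∃ h : (T : Type u) →ₗ[A] Q, ∀ m, h (f m) = k m := by
  obtain ⟨y, hy⟩ := ext_shift f g hfi hg hfg 0 h
    (Abelian.Ext.mk₀ (ModuleCat.ofHom k : K ⟶ ModuleCat.of A Q))
  obtain ⟨y, rfl⟩ := Abelian.Ext.homEquiv₀.symm.surjective y
  change (Abelian.Ext.mk₀ _).comp (Abelian.Ext.mk₀ y) _ = _ at hy
  rw [Abelian.Ext.mk₀_comp_mk₀] at hy
  have := Abelian.Ext.homEquiv₀.symm.injective hy
  exact ⟨y.hom, fun m => congrArg (fun φ => φ.hom m) this⟩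

lemma domdim_eq_add {M X : ModuleCat.{u} A} (t : ℕ)
    (h : ∀ n, DomdimGE R A Q (n + t) M ↔ DomdimGE R A Q n X) :
    Domdim R A Q M = (t : ℕ∞) + Domdim R A Q X := by
  unfold Domdim
  apply le_antisymm
  · refine iSup₂_le fun m hm => ?_
    by_cases hmt : m ≤ t
    · exact le_add_right (by exact_mod_cast hmt)
    · obtain ⟨n, rfl⟩ := Nat.exists_eq_add_of_le (Nat.le_of_not_le hmt)
      rw [add_comm] at hm
      push_cast
      gcongr
      exact le_iSup₂_of_le n ((h n).1 hm) le_rfl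
  · rw [ENat.add_biSup' (p := fun n => DomdimGE R A Q n X) ⟨0, trivial⟩ (fun n : ℕ => (n : ℕ∞))]
    refine iSup₂_le fun n hn => ?_
    refine le_iSup₂_of_le (n + t) ((h n).2 hn) ?_
    push_cast
    rw [add_comm]

end Helpers

end RelDom

open RelDom Function TensorProduct

section Stmt10

variable (R : Type u) [CommRing R] [IsNoetherianRing R]
variable (A : Type u) [Ring A] [Algebra R A] [Module.Finite R A] [Module.Projective R A]
variable (Q : Type u) [AddCommGroup Q] [Module R Q] [Module A Q]
  [IsScalarTower R A Q] [SMulCommClass A R Q] [SMulCommClass R A Q]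
  [Module.Finite A Q] [Module.Projective R Q]

/-- Suppose `Ext_A^{i>0}(Q,Q) = 0` and `DQ ⊗_A Q ∈ R-proj`.
Let `0 → M → C 1 → ⋯ → C t → X → 0` (with `M = C 0` and `X = C (t+1)`) be an
`(A,R)`-exact sequence with `C i ∈ add Q` for `1 ≤ i ≤ t`.  If `Ext_A^i(X,Q) = 0`
for `1 ≤ i ≤ t`, then `Q-domdim_{(A,R)} M = t + Q-domdim_{(A,R)} X`. -/
theorem stmt_10
    (hQQ : Module.Projective R (TensorOver R A (Q →ₗ[R] R) Q))
    (hQext : ∀ i, 0 < i → ExtVanish A (ModuleCat.of A Q) (ModuleCat.of A Q) i)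
    (t : ℕ) (C : ℕ → ModuleCat.{u} A)
    (d : ∀ i, (C i : Type u) →ₗ[A] (C (i+1) : Type u))
    [Module.Finite A (C 0 : Type u)]
    [Module.Projective R (RestrictScalars R A (C 0 : Type u))]
    (hinAdd : ∀ i, 1 ≤ i → i ≤ t → InAdd A Q (C i : Type u))
    (hinj : Injective (d 0)) (hsurj : Surjective (d t))
    (hex : ∀ i, i + 2 ≤ t + 1 →
      LinearMap.ker (d (i+1)) = LinearMap.range (d i))
    (hsplit : ∀ i, i ≤ t → RSummand R A (LinearMap.range (d i)))
    (hXext : ∀ i, 1 ≤ i → i ≤ t →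
      ExtVanish A (C (t+1)) (ModuleCat.of A Q) i) :
    Domdim R A Q (C 0) = (t : ℕ∞) + Domdim R A Q (C (t+1)) := by
  let K : ℕ → ModuleCat.{u} A := fun i => ModuleCat.of A (LinearMap.range (d i))
  let f : ∀ i, (K i : Type u) →ₗ[A] (C (i+1) : Type u) := fun i => (LinearMap.range (d i)).subtype
  let g : ∀ i, (C (i+1) : Type u) →ₗ[A] (K (i+1) : Type u) := fun i => (d (i+1)).rangeRestrict
  have hfi : ∀ i, Injective (f i) := fun i => Submodule.injective_subtype _
  have hg : ∀ i, Surjective (g i) := fun i => LinearMap.surjective_rangeRestrict _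
  have hfg : ∀ i, i + 1 ≤ t → LinearMap.ker (g i) = LinearMap.range (f i) := fun i hi => by
    change LinearMap.ker (d (i+1)).rangeRestrict = LinearMap.range (LinearMap.range (d i)).subtype
    rw [LinearMap.ker_rangeRestrict, Submodule.range_subtype]
    exact hex i (by omega)
  have hfs : ∀ i, i ≤ t → RSplitMono R A (f i) := fun i hi => by
    obtain ⟨r, hr, hr'⟩ := hsplit i hi
    exact ⟨hfi i, r, hr, hr'⟩
  let e0 : (C 0 : Type u) ≃ₗ[A] (K 0 : Type u) := LinearEquiv.ofInjective (d 0) hinj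
  let eX : (K t : Type u) ≃ₗ[A] (C (t+1) : Type u) :=
    LinearEquiv.ofTop _ (LinearMap.range_eq_top.2 hsurj)
  have hEV : ∀ s i, i + s = t → ∀ j, j + 1 ≤ i →
      Subsingleton (CategoryTheory.Abelian.Ext.{u} (K i) (ModuleCat.of A Q) (j + 1)) := by
    intro s
    induction s with
    | zero =>
      intro i hi j hj
      obtain rfl : i = t := by omega
      refine ext_inAdd (Q := (C (i+1) : Type u)) ?_ (j + 1)
        (ext_of_vanish j (hXext (j + 1) (by omega) (by omega)))
      exact inAdd_of_families (ι := Unit) (fun _ => eX.toLinearMap) (fun _ => eX.symm.toLinearMap)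
        (fun m => by simp)
    | succ s ih =>
      intro i hi j hj
      refine subsingleton_of_forall_eq 0 fun x => ?_
      obtain ⟨y, rfl⟩ := ext_shift (f i) (g i) (hfi i) (hg i) (hfg i (by omega)) (j + 1)
        (ih (i + 1) (by omega) (j + 1) (by omega)) x
      have := ext_inAdd (hinAdd (i + 1) (by omega) (by omega)) (j + 1)
        (ext_of_vanish j (hQext (j + 1) (by omega)))
      rw [Subsingleton.elim y 0, CategoryTheory.Abelian.Ext.comp_zero]
  have hstep : ∀ i, i ≤ t → ∀ n, DomdimGE R A Q (n + i) (K 0) ↔ DomdimGE R A Q n (K i) := by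
    intro i
    induction i with
    | zero => intro _ n; exact Iff.rfl
    | succ i ih =>
      intro hi n
      rw [show n + (i + 1) = (n + 1) + i by omega, ih (by omega)]
      exact domdimGE_succ_iff n (hinAdd (i + 1) (by omega) hi) (f i) (g i) (hfs i (by omega))
        (hg i) (hfg i hi) (extend_of_ext (f i) (g i) (hfi i) (hg i) (hfg i hi)
          (hEV (t - (i + 1)) (i + 1) (by omega) 0 (by omega)))
  refine domdim_eq_add t fun n => ?_
  rw [show DomdimGE R A Q (n + t) (C 0) ↔ DomdimGE R A Q (n + t) (K 0) from
    ⟨domdimGE_iso _ e0, domdimGE_iso _ e0.symm⟩, hstep t le_rfl n]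
  exact ⟨domdimGE_iso _ eX, domdimGE_iso _ eX.symm⟩

end Stmt10
end

section
/- Let k be a field, A a finite-dimensional k-algebra, Q a finite-dimensional A-module with Ext_A^{i>0}(Q, Q) = 0. Suppose M satisfies Ext_A^{i>0}(M, Q) = 0 and there is an exact sequence 0 → M → Q_1 → ... → Q_n with each Q_i in add Q. Then Q-domdim_A M ≥ n − idim_A Q, where idim_A Q is the injective dimension of Q. -/
universe u
open Function TensorProduct

open RelDom Function TensorProduct


namespace RelDom

section Helpers

open CategoryTheory

/-- Vanishing of all positive `Ext` groups, in terms of Mathlib's `Abelian.Ext`. -/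
def Acyc (A : Type u) [Ring A] (X Y : ModuleCat.{u} A) : Prop :=
  ∀ i, 0 < i → Subsingleton (Abelian.Ext.{u} X Y i)

lemma acyc_of_extVanish (A : Type u) [Ring A] (X Y : ModuleCat.{u} A)
    (h : ∀ i, 0 < i → ExtVanish A X Y i) : Acyc A X Y := by
  intro i hi
  obtain ⟨p, rfl⟩ : ∃ p, i = p + 1 := ⟨i - 1, by omega⟩
  let P : ProjectiveResolution X := projectiveResolution X
  have h1 := h (p + 1) hi
  have hz : Limits.IsZero ((P.complex.linearYonedaObj ℤ Y).homology (p + 1)) := by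
    refine Limits.IsZero.of_iso ?_ (P.isoExt (R := ℤ) (p + 1) Y).symm
    exact @ModuleCat.isZero_of_subsingleton _ _ _ h1
  rw [← HomologicalComplex.exactAt_iff_isZero_homology,
    HomologicalComplex.exactAt_iff' _ p (p + 1) (p + 2) (by simp) (by simp),
    ShortComplex.moduleCat_exact_iff] at hz
  refine subsingleton_of_forall_eq 0 fun α => ?_
  obtain ⟨f, hf, rfl⟩ := P.extMk_surjective α (p + 2) rfl
  rw [P.extMk_eq_zero_iff f (p + 2) rfl hf p rfl]
  exact hz f hf

/-- The short complex `Z → I → I / Z`. -/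
noncomputable def quotSC (A : Type u) [Ring A] (Z I : ModuleCat.{u} A) (f : Z →ₗ[A] I) :
    ShortComplex (ModuleCat.{u} A) :=
  ShortComplex.mk (ModuleCat.ofHom f)
    (ModuleCat.ofHom (LinearMap.range f).mkQ : I ⟶ ModuleCat.of A (I ⧸ LinearMap.range f))
    (by ext x; simp)

lemma quotSC_shortExact (A : Type u) [Ring A] (Z I : ModuleCat.{u} A) (f : Z →ₗ[A] I)
    (hf : Injective f) : (quotSC A Z I f).ShortExact where
  exact := by
    rw [ShortComplex.moduleCat_exact_iff]
    intro x hx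
    have : x ∈ LinearMap.range f := (Submodule.Quotient.mk_eq_zero _).1 hx
    obtain ⟨y, hy⟩ := this
    exact ⟨y, hy⟩
  mono_f := (ModuleCat.mono_iff_injective _).2 hf
  epi_g := (ModuleCat.epi_iff_surjective _).2 (Submodule.mkQ_surjective _)

lemma acyc_quot (A : Type u) [Ring A] (X Z I : ModuleCat.{u} A) (f : Z →ₗ[A] I)
    (hf : Injective f) (hI : Module.Injective A I) (h : Acyc A X Z) :
    Acyc A X (ModuleCat.of A (I ⧸ LinearMap.range f)) := by
  intro i hi
  obtain ⟨p, rfl⟩ : ∃ p, i = p + 1 := ⟨i - 1, by omega⟩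
  have hS := quotSC_shortExact A Z I f hf
  have : CategoryTheory.Injective I := Module.injective_object_of_injective_module A I
  refine subsingleton_of_forall_eq 0 fun α => ?_
  obtain ⟨x, hx⟩ := Abelian.Ext.covariant_sequence_exact₃ X hS α (n₁ := p + 2) rfl
    ((h (p + 2) (by omega)).elim _ _)
  have h0 : x = 0 := Abelian.Ext.eq_zero_of_injective (I := I) x
  rw [← hx, h0, Abelian.Ext.zero_comp]
  rfl

lemma lift_of_acyc (A : Type u) [Ring A] (X Z I : ModuleCat.{u} A) (f : Z →ₗ[A] I)
    (hf : Injective f) (h : Acyc A X Z) (g : X →ₗ[A] (I ⧸ LinearMap.range f)) :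
    ∃ g' : X →ₗ[A] I, ∀ x, (LinearMap.range f).mkQ (g' x) = g x := by
  have hS := quotSC_shortExact A Z I f hf
  obtain ⟨x, hx⟩ := Abelian.Ext.covariant_sequence_exact₃ X hS
    (Abelian.Ext.mk₀ (ModuleCat.ofHom g :
      X ⟶ ModuleCat.of A (I ⧸ LinearMap.range f))) (n₁ := 1) rfl
    ((h 1 (by omega)).elim _ _)
  obtain ⟨y, rfl⟩ := (Abelian.Ext.mk₀_bijective _ _).2 x
  rw [Abelian.Ext.mk₀_comp_mk₀] at hx
  have hy := (Abelian.Ext.mk₀_bijective _ _).1 hx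
  exact ⟨y.hom, fun t => ConcreteCategory.congr_hom hy t⟩

lemma lift_of_inAdd (A : Type u) [Ring A] (Q : Type u) [AddCommGroup Q] [Module A Q]
    (T : Type u) [AddCommGroup T] [Module A T] (hT : InAdd A Q T)
    (I J : Type u) [AddCommGroup I] [Module A I] [AddCommGroup J] [Module A J]
    (π : I →ₗ[A] J) (h : ∀ g : Q →ₗ[A] J, ∃ g' : Q →ₗ[A] I, ∀ x, π (g' x) = g x)
    (g : T →ₗ[A] J) : ∃ g' : T →ₗ[A] I, ∀ x, π (g' x) = g x := by
  obtain ⟨n, i, p, hip⟩ := hT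
  choose G hG using fun j : Fin n => h (g ∘ₗ p ∘ₗ LinearMap.single A (fun _ => Q) j)
  refine ⟨(∑ j, G j ∘ₗ LinearMap.proj j) ∘ₗ i, fun x => ?_⟩
  simp only [LinearMap.comp_apply, LinearMap.sum_apply, map_sum, hG]
  rw [← map_sum, ← map_sum]
  conv_rhs => rw [← hip x]
  congr 2
  exact Finset.univ_sum_single (i x)

/-- `M` has an exact sequence `0 → M → T₁ → ⋯ → Tₙ` with all `Tᵢ ∈ add Q`. -/
def Cores (A : Type u) [Ring A] (Q : Type u) [AddCommGroup Q] [Module A Q] :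
    ℕ → ModuleCat.{u} A → Prop
  | 0, _ => True
  | n + 1, M =>
      ∃ (T : ModuleCat.{u} A) (_ : InAdd A Q T) (f : M →ₗ[A] T), Injective f ∧
        Cores A Q n (ModuleCat.of A ((T : Type u) ⧸ LinearMap.range f))

lemma Cores.mono {A : Type u} [Ring A] {Q : Type u} [AddCommGroup Q] [Module A Q] :
    ∀ {n m : ℕ} {M : ModuleCat.{u} A}, n ≤ m → Cores A Q m M → Cores A Q n M
  | 0, _, _, _, _ => trivial
  | n + 1, 0, _, h, _ => absurd h (by omega)
  | n + 1, m + 1, _, h, ⟨T, hT, f, hf, hc⟩ =>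
      ⟨T, hT, f, hf, Cores.mono (Nat.le_of_succ_le_succ h) hc⟩

lemma extend_of_injective (A : Type u) [Ring A] (I : Type u) [AddCommGroup I] [Module A I]
    (hI : Module.Injective A I) (N T : Type u) [AddCommGroup N] [Module A N]
    [AddCommGroup T] [Module A T] (f : N →ₗ[A] T) (hf : Injective f) (g : N →ₗ[A] I) :
    ∃ h : T →ₗ[A] I, ∀ x, h (f x) = g x :=
  hI.out f hf g

lemma extend_main (A : Type u) [Ring A] (Q : Type u) [AddCommGroup Q] [Module A Q] :
    ∀ (d : ℕ) (Z : ModuleCat.{u} A), InjCoresLE A d Z → Acyc A (ModuleCat.of A Q) Z →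
    ∀ (N T : ModuleCat.{u} A) (f : N →ₗ[A] T), Injective f →
      Cores A Q d (ModuleCat.of A ((T : Type u) ⧸ LinearMap.range f)) →
      ∀ g : N →ₗ[A] Z, ∃ h : T →ₗ[A] Z, ∀ x, h (f x) = g x := by
  intro d
  induction d with
  | zero =>
    intro Z hZ _ N T f hf _ g
    exact extend_of_injective A Z hZ N T f hf g
  | succ d ih =>
    rintro Z ⟨I, e, hI, he, hZ'⟩ hac N T f hf ⟨T', hT', f', hf', hc⟩ g
    have hac' := acyc_quot A (ModuleCat.of A Q) Z I e he hI hac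
    obtain ⟨G, hG⟩ := extend_of_injective A I hI N T f hf (e ∘ₗ g)
    have hker : LinearMap.range f ≤ LinearMap.ker ((LinearMap.range e).mkQ ∘ₗ G) := by
      rintro _ ⟨x, rfl⟩
      simp [hG]
    let φ : (T ⧸ LinearMap.range f) →ₗ[A] (I ⧸ LinearMap.range e) :=
      (LinearMap.range f).liftQ _ hker
    obtain ⟨ψ, hψ⟩ := ih _ hZ' hac' _ T' f' hf' hc φ
    obtain ⟨χ, hχ⟩ := lift_of_inAdd A Q T' hT' I (I ⧸ LinearMap.range e) (LinearMap.range e).mkQ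
      (fun g => lift_of_acyc A (ModuleCat.of A Q) Z I e he hac g) ψ
    let G' : T →ₗ[A] I := G - χ ∘ₗ f' ∘ₗ (LinearMap.range f).mkQ
    have hG' : ∀ t, G' t ∈ LinearMap.range e := by
      intro t
      rw [← Submodule.Quotient.mk_eq_zero, ← Submodule.mkQ_apply]
      have h1 : (LinearMap.range e).mkQ (χ (f' ((LinearMap.range f).mkQ t)))
          = (LinearMap.range e).mkQ (G t) := by
        rw [hχ, hψ]; rfl
      have h2 : G' t = G t - χ (f' ((LinearMap.range f).mkQ t)) := rfl
      rw [h2, map_sub, h1, sub_self]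
    let E := LinearEquiv.ofInjective e he
    refine ⟨E.symm.toLinearMap ∘ₗ G'.codRestrict _ hG', fun x => ?_⟩
    have h3 : G'.codRestrict _ hG' (f x) = E (g x) := by
      apply Subtype.ext
      have h2 : G' (f x) = G (f x) - χ (f' ((LinearMap.range f).mkQ (f x))) := rfl
      have h4 : (LinearMap.range f).mkQ (f x) = 0 := by simp
      rw [LinearMap.codRestrict_apply, h2, h4, hG]
      erw [map_zero, map_zero]
      simp [E]
    rw [LinearMap.comp_apply, h3]
    exact E.symm_apply_apply _

lemma rsplit_of_injective (k : Type u) [Field k] (A : Type u) [Ring A] [Algebra k A]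
    {M N : Type u} [AddCommGroup M] [Module A M] [AddCommGroup N] [Module A N]
    (f : M →ₗ[A] N) (hf : Injective f) : RSplitMono k A f := by
  refine ⟨hf, ?_⟩
  letI : Module k M := Module.compHom M (algebraMap k A)
  letI : Module k N := Module.compHom N (algebraMap k A)
  let f' : M →ₗ[k] N :=
    { toFun := f, map_add' := f.map_add, map_smul' := fun c x => f.map_smul (algebraMap k A c) x }
  obtain ⟨r, hr⟩ := f'.exists_leftInverse_of_injective (LinearMap.ker_eq_bot.2 hf)
  exact ⟨r.toAddMonoidHom, fun s x => r.map_smul s x, fun m => LinearMap.congr_fun hr m⟩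

lemma domdim_of_cores (k : Type u) [Field k] (A : Type u) [Ring A] [Algebra k A]
    (Q : Type u) [AddCommGroup Q] [Module A Q] (d : ℕ)
    (hd : InjCoresLE A d (ModuleCat.of A Q))
    (hac : Acyc A (ModuleCat.of A Q) (ModuleCat.of A Q)) :
    ∀ (s n : ℕ) (M : ModuleCat.{u} A), s + d ≤ n → Cores A Q n M → DomdimGE k A Q s M := by
  intro s
  induction s with
  | zero => intros; trivial
  | succ s ih =>
    intro n M hn hc
    obtain ⟨T, hT, f, hf, hc⟩ := Cores.mono (n := s + d + 1) (by omega) hc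
    refine ⟨T, hT, f, rsplit_of_injective k A f hf, ?_, ih _ _ le_rfl hc⟩
    exact extend_main A Q d _ hd hac M T f hf (hc.mono (by omega))

lemma cores_of_seq (A : Type u) [Ring A] (Q : Type u) [AddCommGroup Q] [Module A Q]
    (m : ℕ) (C : ℕ → ModuleCat.{u} A)
    (d : ∀ i, (C i : Type u) →ₗ[A] (C (i+1) : Type u))
    (hex : ∀ i, i + 2 ≤ m + 1 → LinearMap.ker (d (i+1)) = LinearMap.range (d i))
    (hinAdd : ∀ i, 1 ≤ i → i ≤ m + 1 → InAdd A Q (C i : Type u)) :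
    ∀ (s j : ℕ), s + j = m + 1 → ∀ (N : ModuleCat.{u} A) (g : N →ₗ[A] C (j + 1)),
      Injective g → LinearMap.range g = LinearMap.range (d j) → Cores A Q s N := by
  intro s
  induction s with
  | zero => intros; trivial
  | succ s ih =>
    intro j hj N g hg hr
    refine ⟨C (j + 1), hinAdd _ (by omega) (by omega), g, hg, ?_⟩
    rcases Nat.eq_zero_or_pos s with rfl | hs
    · trivial
    have hk : LinearMap.range g = LinearMap.ker (d (j + 1)) := by
      rw [hr, hex j (by omega)]
    refine ih (j + 1) (by omega) _ ((LinearMap.range g).liftQ (d (j + 1)) hk.le) ?_ ?_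
    · exact LinearMap.ker_eq_bot.1 (Submodule.ker_liftQ_eq_bot _ _ _ hk.ge)
    · exact Submodule.range_liftQ _ _ _

end Helpers

end RelDom

section Stmt11

variable (k : Type u) [Field k]
variable (A : Type u) [Ring A] [Algebra k A] [Module.Finite k A]
variable (Q : Type u) [AddCommGroup Q] [Module k Q] [Module A Q]
  [IsScalarTower k A Q] [SMulCommClass A k Q] [SMulCommClass k A Q]
  [Module.Finite A Q]

/-- Over a field `k`: if `Ext_A^{i>0}(Q,Q) = 0`,
`Ext_A^{i>0}(M,Q) = 0` and there is an exact sequence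
`0 → M → C 1 → ⋯ → C (m+1)` (with `M = C 0`, of length `n = m+1`) with all
`C i ∈ add Q`, then `Q-domdim_A M ≥ n - idim_A Q`:  for every `dI` with
`idim_A Q ≤ dI` (witnessed by an injective coresolution of length `dI`) one has
`Q-domdim_A M ≥ (m+1) - dI`. -/
theorem stmt_11
    (hQext : ∀ i, 0 < i → ExtVanish A (ModuleCat.of A Q) (ModuleCat.of A Q) i)
    (m : ℕ) (C : ℕ → ModuleCat.{u} A)
    (d : ∀ i, (C i : Type u) →ₗ[A] (C (i+1) : Type u))
    [Module.Finite A (C 0 : Type u)]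
    (hMext : ∀ i, 0 < i → ExtVanish A (C 0) (ModuleCat.of A Q) i)
    (hinj : Injective (d 0))
    (hex : ∀ i, i + 2 ≤ m + 1 →
      LinearMap.ker (d (i+1)) = LinearMap.range (d i))
    (hinAdd : ∀ i, 1 ≤ i → i ≤ m + 1 → InAdd A Q (C i : Type u)) :
    ∀ dI : ℕ, InjCoresLE A dI (ModuleCat.of A Q) →
      DomdimGE k A Q ((m + 1) - dI) (C 0) := by
  intro dI hdI
  rcases Nat.lt_or_ge (m + 1) dI with h | h
  · rw [Nat.sub_eq_zero_of_le h.le]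
    trivial
  exact domdim_of_cores k A Q dI hdI (acyc_of_extVanish A _ _ hQext) _ (m + 1) (C 0)
    (by omega) (cores_of_seq A Q m C d hex hinAdd (m + 1) 0 rfl (C 0) (d 0) hinj rfl)

end Stmt11
end

section
/- Let A be a finite-dimensional algebra over a field k, Q a finite-dimensional A-module, B = End_A(Q)^op, and M a finitely generated A-module such that Tor_i^B(Q, Hom_A(Q, M)) = 0 for 1 ≤ i ≤ q. Then for any A-module X with Ext_A^{i>0}(Q, X) = 0, there are isomorphisms Ext_A^i(Q ⊗_B Hom_A(Q, M), X) ≅ Ext_B^i(Hom_A(Q, M), Hom_A(Q, X)) for all 0 ≤ i ≤ q. -/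
universe u
open Function TensorProduct

open RelDom Function TensorProduct



namespace Stmt14Aux

open RelDom Function TensorProduct

section PM

variable {S : Type u} [Ring S]
variable {Y : Type u} [AddCommGroup Y] [Module Sᵐᵒᵖ Y]
variable {Z : Type u} [AddCommGroup Z] [Module Sᵐᵒᵖ Z]

/-- `piMap` as an additive homomorphism. -/
noncomputable def pm (Y : Type u) [AddCommGroup Y] [Module Sᵐᵒᵖ Y]
    {m n : ℕ} (d : (Fin m → S) →ₗ[S] (Fin n → S)) :
    (Fin m → Y) →+ (Fin n → Y) where
  toFun := piMap S Y d
  map_zero' := by ext i; simp [piMap]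
  map_add' v w := by ext i; simp [piMap, smul_add, Finset.sum_add_distrib]

lemma pm_apply {m n : ℕ} (d : (Fin m → S) →ₗ[S] (Fin n → S)) (v : Fin m → Y) (i : Fin n) :
    pm Y d v i = ∑ j, MulOpposite.op (d (Pi.single j 1) i) • v j := rfl

lemma pm_nat {m n : ℕ} (d : (Fin m → S) →ₗ[S] (Fin n → S)) (f : Y →ₗ[Sᵐᵒᵖ] Z)
    (v : Fin m → Y) : pm Z d (fun j => f (v j)) = fun i => f (pm Y d v i) := by
  ext i; simp [pm_apply]

lemma d_expand {m n : ℕ} (d : (Fin m → S) →ₗ[S] (Fin n → S)) (t : Fin m → S) (i : Fin n) :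
    d t i = ∑ j, t j * d (Pi.single j 1) i := by
  conv_lhs => rw [← Finset.univ_sum_single t, map_sum]
  rw [Finset.sum_apply]
  refine Finset.sum_congr rfl fun j _ => ?_
  have : (Pi.single j (t j) : Fin m → S) = t j • Pi.single j 1 := by
    rw [← Pi.single_smul]; simp
  rw [this, map_smul]; rfl

lemma pm_smul {m n : ℕ} (d : (Fin m → S) →ₗ[S] (Fin n → S)) (t : Fin m → S) (y : Y) :
    pm Y d (fun j => MulOpposite.op (t j) • y) = fun i => MulOpposite.op (d t i) • y := by
  ext i
  rw [pm_apply, d_expand, Finset.op_sum, Finset.sum_smul]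
  refine Finset.sum_congr rfl fun j _ => ?_
  rw [smul_smul, MulOpposite.op_mul]

lemma vec_expand {m : ℕ} (v : Fin m → Y) :
    v = ∑ j, fun i => MulOpposite.op ((Pi.single j 1 : Fin m → S) i) • v j := by
  ext i
  rw [Finset.sum_apply, Finset.sum_eq_single i]
  · simp
  · intro j _ h; simp [Pi.single_eq_of_ne h.symm]
  · simp

lemma pm_pm {m n l : ℕ} (d : (Fin m → S) →ₗ[S] (Fin n → S)) (d' : (Fin l → S) →ₗ[S] (Fin m → S))
    (h : ∀ t, d (d' t) = 0) (v : Fin l → Y) : pm Y d (pm Y d' v) = 0 := by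
  rw [vec_expand (S := S) v, map_sum, map_sum]
  refine Finset.sum_eq_zero fun j _ => ?_
  rw [pm_smul, pm_smul, h]
  ext i; simp

/-- exactness of the tensored complex at one spot -/
def ExAt (Y : Type u) [AddCommGroup Y] [Module Sᵐᵒᵖ Y] {m n l : ℕ}
    (d : (Fin m → S) →ₗ[S] (Fin n → S)) (d' : (Fin l → S) →ₗ[S] (Fin m → S)) : Prop :=
  ∀ v : Fin m → Y, pm Y d v = 0 → ∃ w, pm Y d' w = v

lemma pm_op {m n : ℕ} (d : (Fin m → S) →ₗ[S] (Fin n → S)) (t : Fin m → Sᵐᵒᵖ) :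
    pm Sᵐᵒᵖ d t = fun i => MulOpposite.op (d (fun j => (t j).unop) i) := by
  have := pm_smul (Y := Sᵐᵒᵖ) d (fun j => (t j).unop) 1
  simpa using this

lemma exAt_free (I : Type u) {m n l : ℕ}
    (d : (Fin m → S) →ₗ[S] (Fin n → S)) (d' : (Fin l → S) →ₗ[S] (Fin m → S))
    (h : LinearMap.ker d = LinearMap.range d') : ExAt (I →₀ Sᵐᵒᵖ) d d' := by
  classical
  intro v hv
  have key : ∀ i : I, ∃ w : Fin l → Sᵐᵒᵖ, pm Sᵐᵒᵖ d' w = (fun j => v j i) ∧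
      ((∀ j, v j i = 0) → w = 0) := by
    intro i
    by_cases h0 : ∀ j, v j i = 0
    · exact ⟨0, by rw [map_zero]; ext j; simp [h0], fun _ => rfl⟩
    have h1 : pm Sᵐᵒᵖ d (fun j => v j i) = 0 := by
      have := pm_nat d (Finsupp.lapply i : (I →₀ Sᵐᵒᵖ) →ₗ[Sᵐᵒᵖ] Sᵐᵒᵖ) v
      rw [hv] at this
      rw [show (fun j => v j i) = fun j => Finsupp.lapply (R := Sᵐᵒᵖ) i (v j) from rfl, this]
      ext a; simp
    rw [pm_op] at h1
    have h2 : (fun j => (v j i).unop) ∈ LinearMap.ker d := by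
      rw [LinearMap.mem_ker]; ext a
      have := congrFun h1 a
      simpa using this
    rw [h] at h2
    obtain ⟨t, ht⟩ := h2
    refine ⟨fun j => MulOpposite.op (t j), ?_, fun h3 => absurd h3 h0⟩
    rw [pm_op]; ext a
    simp [ht]
  choose w hw hw0 using key
  refine ⟨fun b => Finsupp.onFinset (Finset.univ.biUnion fun j => (v j).support)
    (fun i => w i b) ?_, ?_⟩
  · intro i hi
    by_contra hc
    apply hi
    rw [hw0 i]; · rfl
    intro j
    by_contra hj
    exact hc (Finset.mem_biUnion.2 ⟨j, Finset.mem_univ _, Finsupp.mem_support_iff.2 hj⟩)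
  · ext j i : 2
    have := pm_nat d' (Finsupp.lapply i : (I →₀ Sᵐᵒᵖ) →ₗ[Sᵐᵒᵖ] Sᵐᵒᵖ)
      (fun b => Finsupp.onFinset (Finset.univ.biUnion fun j => (v j).support)
    (fun i => w i b) (by
      intro i hi
      by_contra hc
      apply hi
      rw [hw0 i]; · rfl
      intro j
      by_contra hj
      exact hc (Finset.mem_biUnion.2 ⟨j, Finset.mem_univ _, Finsupp.mem_support_iff.2 hj⟩)))
    have := congrFun this j
    simp only [Finsupp.lapply_apply] at this
    rw [← this]
    exact congrFun (hw i) j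

/-- dimension shift for Tor -/
lemma exAt_shift {K F Y : Type u} [AddCommGroup K] [Module Sᵐᵒᵖ K] [AddCommGroup F] [Module Sᵐᵒᵖ F]
    [AddCommGroup Y] [Module Sᵐᵒᵖ Y] (f : K →ₗ[Sᵐᵒᵖ] F) (g : F →ₗ[Sᵐᵒᵖ] Y)
    (hf : Injective f) (hg : Surjective g) (hfg : LinearMap.ker g = LinearMap.range f)
    {b c e : ℕ} (d₁ : (Fin c → S) →ₗ[S] (Fin b → S))
    (d₂ : (Fin e → S) →ₗ[S] (Fin c → S))
    (h12 : ∀ t, d₁ (d₂ t) = 0) (hY : ExAt Y d₁ d₂) (v : Fin b → K)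
    (w : Fin c → F) (hw : pm F d₁ w = fun j => f (v j)) : ∃ w', pm K d₁ w' = v := by
  have hgf : ∀ x, g (f x) = 0 := fun x => by
    have : f x ∈ LinearMap.ker g := hfg ▸ ⟨x, rfl⟩
    exact this
  obtain ⟨u, hu⟩ := hY (fun j => g (w j)) (by rw [pm_nat, hw]; ext; simp [hgf])
  choose u' hu' using fun j => hg (u j)
  have h3 : ∀ j, w j - pm F d₂ u' j ∈ LinearMap.range f := by
    intro j
    rw [← hfg, LinearMap.mem_ker, map_sub]
    have := congrFun (pm_nat d₂ g u') j
    simp only [hu'] at this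
    rw [← this, hu, sub_self]
  choose w' hw' using h3
  refine ⟨w', ?_⟩
  ext i
  apply hf
  have h4 := congrFun (pm_nat d₁ f w') i
  rw [← h4]
  have h5 : (fun j => f (w' j)) = w - pm F d₂ u' := by ext j; rw [hw']; rfl
  rw [h5, map_sub, pm_pm _ _ h12, sub_zero, hw]

end PM


section QT

variable {A : Type u} [Ring A] {Q : Type u} [AddCommGroup Q] [Module A Q]

/-- relations for `Q ⊗_B Y` -/
def qtRel (A Q : Type u) [Ring A] [AddCommGroup Q] [Module A Q]
    (Y : Type u) [AddCommGroup Y] [Module (Module.End A Q)ᵐᵒᵖ Y] : Set (Q ⊗[ℤ] Y) :=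
  {z | ∃ (q : Q) (b : Module.End A Q) (y : Y),
    z = (b q) ⊗ₜ[ℤ] y - q ⊗ₜ[ℤ] (MulOpposite.op b • y)}

/-- `Q ⊗_B Y` -/
abbrev QT (A Q : Type u) [Ring A] [AddCommGroup Q] [Module A Q]
    (Y : Type u) [AddCommGroup Y] [Module (Module.End A Q)ᵐᵒᵖ Y] : Type u :=
  (Q ⊗[ℤ] Y) ⧸ Submodule.span A (qtRel A Q Y)

variable {Y : Type u} [AddCommGroup Y] [Module (Module.End A Q)ᵐᵒᵖ Y]
variable {Z : Type u} [AddCommGroup Z] [Module (Module.End A Q)ᵐᵒᵖ Z]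
variable {X : Type u} [AddCommGroup X] [Module A X]

/-- pure tensors -/
noncomputable def qtmk (q : Q) (y : Y) : QT A Q Y :=
  Submodule.Quotient.mk (q ⊗ₜ[ℤ] y)

lemma qtmk_add_left (q q' : Q) (y : Y) : (qtmk (q + q') y : QT A Q Y) = qtmk q y + qtmk q' y := by
  simp [qtmk, TensorProduct.add_tmul]

lemma qtmk_add_right (q : Q) (y y' : Y) :
    (qtmk q (y + y') : QT A Q Y) = qtmk q y + qtmk q y' := by
  simp [qtmk, TensorProduct.tmul_add]

lemma qtmk_smul (a : A) (q : Q) (y : Y) : (qtmk (a • q) y : QT A Q Y) = a • qtmk q y := by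
  rw [qtmk, qtmk, ← Submodule.Quotient.mk_smul, TensorProduct.smul_tmul']

lemma qtmk_bal (b : Module.End A Q) (q : Q) (y : Y) :
    (qtmk (b q) y : QT A Q Y) = qtmk q (MulOpposite.op b • y) :=
  (Submodule.Quotient.eq _).2 (Submodule.subset_span ⟨q, b, y, rfl⟩)

lemma qt_induction {p : QT A Q Y → Prop} (h0 : p 0) (hm : ∀ q y, p (qtmk q y))
    (ha : ∀ x y, p x → p y → p (x + y)) (z : QT A Q Y) : p z := by
  obtain ⟨z, rfl⟩ := Submodule.Quotient.mk_surjective _ z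
  induction z with
  | zero => exact h0
  | tmul q y => exact hm q y
  | add x y hx hy => exact ha _ _ hx hy

lemma qt_hom_ext {f g : QT A Q Y →ₗ[A] X} (h : ∀ q y, f (qtmk q y) = g (qtmk q y)) : f = g := by
  refine LinearMap.ext fun z => ?_
  induction z using qt_induction with
  | h0 => simp
  | hm q y => exact h q y
  | ha x y hx hy => rw [map_add, map_add, hx, hy]

/-- The unit `Y → Hom_A(Q, Q ⊗ Y)`. -/
noncomputable def qtUnit (A Q : Type u) [Ring A] [AddCommGroup Q] [Module A Q]
    (Y : Type u) [AddCommGroup Y] [Module (Module.End A Q)ᵐᵒᵖ Y] :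
    Y →ₗ[(Module.End A Q)ᵐᵒᵖ] (Q →ₗ[A] QT A Q Y) where
  toFun y :=
    { toFun := fun q => qtmk q y
      map_add' := fun q q' => qtmk_add_left q q' y
      map_smul' := fun a q => qtmk_smul a q y }
  map_add' y y' := by ext q; exact qtmk_add_right q y y'
  map_smul' b y := by ext q; exact (qtmk_bal b.unop q y).symm

lemma qtUnit_apply (y : Y) (q : Q) : qtUnit A Q Y y q = qtmk q y := rfl

/-- additive lift out of `Q ⊗_ℤ Y`. -/
noncomputable def preLift (φ : Y →ₗ[(Module.End A Q)ᵐᵒᵖ] (Q →ₗ[A] X)) : Q ⊗[ℤ] Y →ₗ[A] X :=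
  TensorProduct.AlgebraTensorModule.lift
    { toFun := fun q =>
        { toFun := fun y => φ y q
          map_add' := fun y y' => by simp
          map_smul' := fun n y => by simp }
      map_add' := fun q q' => by ext y; simp
      map_smul' := fun a q => by ext y; simp }

/-- lift -/
noncomputable def qtLift (φ : Y →ₗ[(Module.End A Q)ᵐᵒᵖ] (Q →ₗ[A] X)) : QT A Q Y →ₗ[A] X :=
  Submodule.liftQ _ (preLift φ) (by
    rw [Submodule.span_le]
    rintro z ⟨q, b, y, rfl⟩
    simp [preLift, homEnd_smul_apply])

@[simp] lemma qtLift_mk (φ : Y →ₗ[(Module.End A Q)ᵐᵒᵖ] (Q →ₗ[A] X)) (q : Q) (y : Y) :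
    qtLift φ (qtmk q y) = φ y q := by
  simp [qtLift, qtmk, preLift]

/-- postcomposition is `B`-linear -/
def postB {X' : Type u} [AddCommGroup X'] [Module A X'] (f : X →ₗ[A] X') :
    (Q →ₗ[A] X) →ₗ[(Module.End A Q)ᵐᵒᵖ] (Q →ₗ[A] X') where
  toFun g := f ∘ₗ g
  map_add' g g' := by ext; simp
  map_smul' b g := rfl

/-- Tensor-hom adjunction -/
noncomputable def qtAdj : (QT A Q Y →ₗ[A] X) ≃+ (Y →ₗ[(Module.End A Q)ᵐᵒᵖ] (Q →ₗ[A] X)) where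
  toFun f := postB f ∘ₗ qtUnit A Q Y
  invFun := qtLift
  left_inv f := qt_hom_ext fun q y => by simp [postB, qtUnit]
  right_inv φ := by ext y q; simp [postB, qtUnit]
  map_add' f g := by ext y q; simp [postB, qtUnit]

lemma qtAdj_apply (f : QT A Q Y →ₗ[A] X) (y : Y) (q : Q) : qtAdj f y q = f (qtmk q y) := rfl

/-- functoriality -/
noncomputable def qtMap (f : Y →ₗ[(Module.End A Q)ᵐᵒᵖ] Z) : QT A Q Y →ₗ[A] QT A Q Z :=
  qtLift (qtUnit A Q Z ∘ₗ f)

@[simp] lemma qtMap_mk (f : Y →ₗ[(Module.End A Q)ᵐᵒᵖ] Z) (q : Q) (y : Y) :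
    qtMap f (qtmk q y) = qtmk q (f y) := by simp [qtMap, qtUnit]

lemma qtAdj_nat (f : Y →ₗ[(Module.End A Q)ᵐᵒᵖ] Z) (g : QT A Q Z →ₗ[A] X) :
    qtAdj (g ∘ₗ qtMap f) = qtAdj g ∘ₗ f := by
  ext y q; simp [qtAdj_apply]

lemma qtMap_surj (f : Y →ₗ[(Module.End A Q)ᵐᵒᵖ] Z) (hf : Surjective f) :
    Surjective (qtMap f) := by
  intro z
  induction z using qt_induction with
  | h0 => exact ⟨0, map_zero _⟩
  | hm q y => obtain ⟨y, rfl⟩ := hf y; exact ⟨qtmk q y, by simp⟩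
  | ha x y hx hy =>
    obtain ⟨a, rfl⟩ := hx
    obtain ⟨b, rfl⟩ := hy
    exact ⟨a + b, map_add _ _ _⟩

lemma qtMap_exact {K F : Type u} [AddCommGroup K] [Module (Module.End A Q)ᵐᵒᵖ K] [AddCommGroup F]
    [Module (Module.End A Q)ᵐᵒᵖ F] (f : K →ₗ[(Module.End A Q)ᵐᵒᵖ] F)
    (g : F →ₗ[(Module.End A Q)ᵐᵒᵖ] Y) (hg : Surjective g)
    (hfg : LinearMap.ker g = LinearMap.range f) :
    LinearMap.ker (qtMap g) = LinearMap.range (qtMap f) := by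
  apply le_antisymm
  · let p := (LinearMap.range (qtMap f)).mkQ
    have hφ : LinearMap.ker g ≤ LinearMap.ker (qtAdj p) := by
      rw [hfg]
      rintro _ ⟨x, rfl⟩
      rw [LinearMap.mem_ker]
      ext q
      rw [qtAdj_apply, ← qtMap_mk]
      exact (Submodule.Quotient.mk_eq_zero _).2 ⟨_, rfl⟩
    let ψ : Y →ₗ[(Module.End A Q)ᵐᵒᵖ] (Q →ₗ[A] _) :=
      (LinearMap.ker g).liftQ (qtAdj p) hφ ∘ₗ (g.quotKerEquivOfSurjective hg).symm.toLinearMap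
    have hψ : ∀ x, ψ (g x) = qtAdj p x := by
      intro x
      have : (g.quotKerEquivOfSurjective hg).symm (g x) = Submodule.Quotient.mk x := by
        rw [LinearEquiv.symm_apply_eq]; rfl
      simp [ψ, this]
    have hp : p = qtLift ψ ∘ₗ qtMap g := qt_hom_ext fun q x => by
      simp [hψ, qtAdj_apply]
    intro z hz
    rw [← Submodule.ker_mkQ (LinearMap.range (qtMap f))]
    change p z = 0
    rw [hp, LinearMap.comp_apply, LinearMap.mem_ker.1 hz, map_zero]
  · rintro _ ⟨z, rfl⟩
    rw [LinearMap.mem_ker]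
    have : qtMap g ∘ₗ qtMap f = 0 := qt_hom_ext fun q x => by
      have : g (f x) = 0 := LinearMap.mem_ker.1 (hfg ▸ ⟨x, rfl⟩)
      simp only [LinearMap.comp_apply, qtMap_mk, this]
      simp [qtmk]
    exact LinearMap.congr_fun this z

/-- `Q ⊗_B B^(I) ≅ Q^(I)`. -/
noncomputable def qtFree (I : Type u) : QT A Q (I →₀ (Module.End A Q)ᵐᵒᵖ) ≃ₗ[A] (I →₀ Q) :=
  LinearEquiv.ofLinearMap
    (qtLift
      { toFun := fun y =>
          { toFun := fun q => y.mapRange (fun b => b.unop q) (by simp)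
            map_add' := fun q q' => by ext i; simp
            map_smul' := fun a q => by ext i; simp }
        map_add' := fun y y' => by ext q i; simp
        map_smul' := fun b y => by ext q i; simp [homEnd_smul_apply] })
    (Finsupp.lsum ℕ fun i => qtUnit A Q _ (Finsupp.single i 1))
    (by
      ext i q j
      simp only [LinearMap.comp_apply, Finsupp.lsum_apply, Finsupp.lsingle_apply,
        LinearMap.id_apply]
      rw [Finsupp.sum_single_index (by exact map_zero _), qtUnit_apply, qtLift_mk]
      simp)
    (qt_hom_ext fun q y => by
      simp only [LinearMap.comp_apply, qtLift_mk, LinearMap.id_apply]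
      induction y using Finsupp.induction_linear with
      | zero => simp [qtmk]
      | add y y' h h' => rw [map_add, LinearMap.add_apply, map_add, h, h', qtmk_add_right]
      | single i b =>
        simp only [LinearMap.coe_mk, AddHom.coe_mk, Finsupp.mapRange_single, Finsupp.lsum_apply]
        rw [Finsupp.sum_single_index (by exact map_zero _), qtUnit_apply, qtmk_bal]
        simp)

end QT

section Inj

variable {A : Type u} [Ring A] {Q : Type u} [AddCommGroup Q] [Module A Q]

section

variable {Y : Type u} [AddCommGroup Y] [Module (Module.End A Q)ᵐᵒᵖ Y]
variable {a b : ℕ}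
  (d : (Fin b → Module.End A Q) →ₗ[Module.End A Q] (Fin a → Module.End A Q))
  (ε : (Fin a → Module.End A Q) →ₗ[Module.End A Q] Q)

/-- `Y^a → Q ⊗ Y`. -/
noncomputable def psi : (Fin a → Y) →+ QT A Q Y where
  toFun v := ∑ i, qtmk (ε (Pi.single i 1)) (v i)
  map_zero' := Finset.sum_eq_zero fun i _ => by simp [qtmk]
  map_add' v w := by
    rw [← Finset.sum_add_distrib]
    exact Finset.sum_congr rfl fun i _ => qtmk_add_right _ _ _

lemma psi_apply (v : Fin a → Y) : psi ε v = ∑ i, qtmk (ε (Pi.single i 1)) (v i) := rfl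

lemma eps_expand (t : Fin a → Module.End A Q) : ε t = ∑ i, t i (ε (Pi.single i 1)) := by
  conv_lhs => rw [← Finset.univ_sum_single t, map_sum]
  refine Finset.sum_congr rfl fun j _ => ?_
  have : (Pi.single j (t j) : Fin a → Module.End A Q) = t j • Pi.single j 1 := by
    rw [← Pi.single_smul]; simp
  rw [this, map_smul]; rfl

lemma qtmk_sum_left {ι : Type*} (s : Finset ι) (f : ι → Q) (y : Y) :
    (qtmk (∑ i ∈ s, f i) y : QT A Q Y) = ∑ i ∈ s, qtmk (f i) y :=
  map_sum (qtUnit A Q Y y) f s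

lemma qtmk_zero_left (y : Y) : (qtmk 0 y : QT A Q Y) = 0 := map_zero (qtUnit A Q Y y)

lemma psi_smul (t : Fin a → Module.End A Q) (y : Y) :
    psi ε (fun i => MulOpposite.op (t i) • y) = qtmk (ε t) y := by
  rw [psi_apply, eps_expand, qtmk_sum_left]
  exact Finset.sum_congr rfl fun i _ => (qtmk_bal _ _ _).symm

lemma psi_pm (h : ∀ t, ε (d t) = 0) (v : Fin b → Y) : psi ε (pm Y d v) = 0 := by
  rw [vec_expand (S := Module.End A Q) v, map_sum, map_sum]
  refine Finset.sum_eq_zero fun j _ => ?_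
  rw [pm_smul, psi_smul, h, qtmk_zero_left]

lemma psi_surj (hε : Surjective ε) : Surjective (psi (Y := Y) ε) := by
  intro z
  induction z using qt_induction with
  | h0 => exact ⟨0, map_zero _⟩
  | hm q y => obtain ⟨t, rfl⟩ := hε q; exact ⟨_, psi_smul ε t y⟩
  | ha x y hx hy =>
    obtain ⟨v, rfl⟩ := hx
    obtain ⟨w, rfl⟩ := hy
    exact ⟨v + w, map_add _ _ _⟩

/-- `E^a × Y → coker` -/
noncomputable def bigTheta (Y : Type u) [AddCommGroup Y] [Module (Module.End A Q)ᵐᵒᵖ Y] :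
    (Fin a → Module.End A Q) →+ Y →+ ((Fin a → Y) ⧸ (pm Y d).range) where
  toFun t :=
    { toFun := fun y => QuotientAddGroup.mk (fun i => MulOpposite.op (t i) • y)
      map_zero' := by
        rw [← QuotientAddGroup.mk_zero]; congr 1; ext i; simp
      map_add' := fun y y' => by
        rw [← QuotientAddGroup.mk_add]; congr 1; ext i; simp }
  map_zero' := by
    ext y
    simp only [AddMonoidHom.coe_mk, ZeroHom.coe_mk, AddMonoidHom.zero_apply]
    rw [← QuotientAddGroup.mk_zero]; congr 1; ext i; simp
  map_add' t t' := by
    ext y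
    simp only [AddMonoidHom.coe_mk, ZeroHom.coe_mk, AddMonoidHom.add_apply]
    rw [← QuotientAddGroup.mk_add]; congr 1; ext i; simp [add_smul]

lemma bigTheta_apply (t : Fin a → Module.End A Q) (y : Y) :
    bigTheta d Y t y = QuotientAddGroup.mk (fun i => MulOpposite.op (t i) • y) := rfl

lemma bigTheta_eq (h : LinearMap.ker ε = LinearMap.range d) {t t' : Fin a → Module.End A Q}
    (htt : ε t = ε t') : bigTheta d Y t = bigTheta d Y t' := by
  have : t - t' ∈ LinearMap.range d := by
    rw [← h, LinearMap.mem_ker, map_sub, htt, sub_self]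
  obtain ⟨s, hs⟩ := this
  have h2 : t = d s + t' := by rw [hs, sub_add_cancel]
  rw [h2, map_add]
  ext y
  rw [AddMonoidHom.add_apply]
  have h3 : bigTheta d Y (d s) y = 0 := by
    rw [bigTheta_apply, QuotientAddGroup.eq_zero_iff]
    exact ⟨_, pm_smul d s y⟩
  rw [h3, zero_add]

/-- `Q × Y → coker` -/
noncomputable def theta0 (hε : Surjective ε) (h : LinearMap.ker ε = LinearMap.range d) :
    Q →+ Y →+ ((Fin a → Y) ⧸ (pm Y d).range) :=
  AddMonoidHom.mk' (fun q => bigTheta d Y (surjInv hε q)) fun q q' => by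
    rw [← map_add]
    apply bigTheta_eq d ε h
    simp [surjInv_eq]

lemma theta0_eps (hε : Surjective ε) (h : LinearMap.ker ε = LinearMap.range d)
    (t : Fin a → Module.End A Q) : theta0 (Y := Y) d ε hε h (ε t) = bigTheta d Y t :=
  bigTheta_eq d ε h (surjInv_eq hε _)

lemma theta0_bal (hε : Surjective ε) (h : LinearMap.ker ε = LinearMap.range d)
    (q : Q) (e : Module.End A Q) (y : Y) :
    theta0 d ε hε h (e q) y = theta0 d ε hε h q (MulOpposite.op e • y) := by
  obtain ⟨t, rfl⟩ := hε q
  have : e (ε t) = ε (e • t) := by rw [map_smul]; rfl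
  rw [this, theta0_eps, theta0_eps, bigTheta_apply, bigTheta_apply]
  congr 1
  ext i
  simp [smul_smul]

/-- `Q ⊗_ℤ Y → coker` -/
noncomputable def theta1 (hε : Surjective ε) (h : LinearMap.ker ε = LinearMap.range d) :
    Q ⊗[ℤ] Y →+ ((Fin a → Y) ⧸ (pm Y d).range) :=
  TensorProduct.liftAddHom (theta0 d ε hε h) fun n q y => by simp

/-- `Q ⊗_B Y → coker` -/
noncomputable def theta (hε : Surjective ε) (h : LinearMap.ker ε = LinearMap.range d) :
    QT A Q Y →+ ((Fin a → Y) ⧸ (pm Y d).range) :=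
  QuotientAddGroup.lift (Submodule.span A (qtRel A Q Y)).toAddSubgroup (theta1 d ε hε h) (by
    intro z hz
    have key : ∀ c : A, theta1 (Y := Y) d ε hε h (c • z) = 0 := by
      refine Submodule.span_induction (p := fun z _ => ∀ c : A, theta1 d ε hε h (c • z) = 0)
        ?_ ?_ ?_ ?_ hz
      · rintro _ ⟨q, e, y, rfl⟩ c
        rw [smul_sub, TensorProduct.smul_tmul', TensorProduct.smul_tmul', ← map_smul, map_sub,
          sub_eq_zero]
        exact theta0_bal d ε hε h _ _ _
      · intro c; simp
      · intro x y _ _ hx hy c; rw [smul_add, map_add, hx, hy, add_zero]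
      · intro e x _ hx c; rw [smul_smul, hx]
    simpa using key 1)

lemma theta_mk (hε : Surjective ε) (h : LinearMap.ker ε = LinearMap.range d) (q : Q) (y : Y) :
    theta d ε hε h (qtmk q y) = theta0 d ε hε h q y := rfl

lemma theta_psi (hε : Surjective ε) (h : LinearMap.ker ε = LinearMap.range d) (v : Fin a → Y) :
    theta d ε hε h (psi ε v) = QuotientAddGroup.mk v := by
  conv_rhs => rw [vec_expand (S := Module.End A Q) v]
  rw [psi_apply, map_sum, QuotientAddGroup.mk_sum]
  refine Finset.sum_congr rfl fun i _ => ?_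
  rw [theta_mk, theta0_eps, bigTheta_apply]

lemma psi_eq_zero (hε : Surjective ε) (h : LinearMap.ker ε = LinearMap.range d) (v : Fin a → Y)
    (hv : psi ε v = 0) : ∃ w, pm Y d w = v := by
  have := theta_psi d ε hε h v
  rw [hv, map_zero] at this
  exact (QuotientAddGroup.eq_zero_iff _).1 this.symm

end

lemma qtMap_inj {K F Y : Type u} [AddCommGroup K] [Module (Module.End A Q)ᵐᵒᵖ K] [AddCommGroup F]
    [Module (Module.End A Q)ᵐᵒᵖ F] [AddCommGroup Y] [Module (Module.End A Q)ᵐᵒᵖ Y]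
    (f : K →ₗ[(Module.End A Q)ᵐᵒᵖ] F)
    (g : F →ₗ[(Module.End A Q)ᵐᵒᵖ] Y) (hf : Injective f) (hg : Surjective g)
    (hfg : LinearMap.ker g = LinearMap.range f) {a b c : ℕ}
    (d : (Fin b → Module.End A Q) →ₗ[Module.End A Q] (Fin a → Module.End A Q))
    (d' : (Fin c → Module.End A Q) →ₗ[Module.End A Q] (Fin b → Module.End A Q))
    (ε : (Fin a → Module.End A Q) →ₗ[Module.End A Q] Q) (hε : Surjective ε)
    (h : LinearMap.ker ε = LinearMap.range d) (h' : LinearMap.ker d = LinearMap.range d')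
    (hY : ExAt Y d d') : Injective (qtMap f) := by
  rw [injective_iff_map_eq_zero]
  intro z hz
  obtain ⟨v, rfl⟩ := psi_surj (Y := K) ε hε z
  have h1 : psi ε (fun i => f (v i)) = 0 := by
    rw [← hz, psi_apply, psi_apply, map_sum]; simp
  obtain ⟨w, hw⟩ := psi_eq_zero d ε hε h _ h1
  have h2 : ∀ t, d (d' t) = 0 := fun t => LinearMap.mem_ker.1 (h' ▸ ⟨t, rfl⟩)
  have h3 : ∀ t, ε (d t) = 0 := fun t => LinearMap.mem_ker.1 (h ▸ ⟨t, rfl⟩)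
  obtain ⟨w', rfl⟩ := exAt_shift f g hf hg hfg d d' h2 hY v w hw
  exact psi_pm d ε h3 w'

end Inj

section CD

variable (k : Type u) [Field k]
variable (A : Type u) [Ring A] [Algebra k A]
variable (Q : Type u) [AddCommGroup Q] [Module k Q] [Module A Q]
  [IsScalarTower k A Q] [SMulCommClass A k Q] [SMulCommClass k A Q]
variable (M : Type u) [AddCommGroup M] [Module k M] [Module A M]
  [IsScalarTower k A M] [SMulCommClass A k M] [SMulCommClass k A M]

/-- `q ⊗ g` in `CounitDom`. -/
noncomputable def cdUnit :
    (Q →ₗ[A] M) →ₗ[(Module.End A Q)ᵐᵒᵖ] (Q →ₗ[A] CounitDom k A Q M) where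
  toFun g :=
    { toFun := fun q => Submodule.Quotient.mk (q ⊗ₜ[k] g)
      map_add' := fun q q' => by rw [TensorProduct.add_tmul]; rfl
      map_smul' := fun a q => by
        rw [← TensorProduct.smul_tmul', Submodule.Quotient.mk_smul]; rfl }
  map_add' g g' := by ext q; simp [TensorProduct.tmul_add]
  map_smul' b g := by
    ext q
    have h : (b.unop q) ⊗ₜ[k] g - q ⊗ₜ[k] (g ∘ₗ b.unop) ∈
        Submodule.span A (counitRel k A Q M) := Submodule.subset_span ⟨q, b.unop, g, rfl⟩
    exact ((Submodule.Quotient.eq _).2 h).symm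

/-- preliminary inverse -/
noncomputable def cdInv0 : (Q ⊗[k] (Q →ₗ[A] M)) →ₗ[A] QT A Q (Q →ₗ[A] M) :=
  TensorProduct.AlgebraTensorModule.lift
    { toFun := fun q =>
        { toFun := fun g => qtmk q g
          map_add' := fun g g' => qtmk_add_right q g g'
          map_smul' := fun c g => by
            have h1 : c • g = MulOpposite.op (algebraMap k (Module.End A Q) c) • g := by
              ext x
              rw [homEnd_smul_apply]
              simp [Module.algebraMap_end_apply]
            rw [h1, ← qtmk_bal, Module.algebraMap_end_apply, ← algebraMap_smul A c q,
              qtmk_smul, algebraMap_smul]; rfl }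
      map_add' := fun q q' => by ext g; exact qtmk_add_left q q' g
      map_smul' := fun a q => by ext g; exact qtmk_smul a q g }

/-- inverse -/
noncomputable def cdInv : CounitDom k A Q M →ₗ[A] QT A Q (Q →ₗ[A] M) :=
  Submodule.liftQ _ (cdInv0 k A Q M) (by
    rw [Submodule.span_le]
    rintro z ⟨q, b, g, rfl⟩
    rw [SetLike.mem_coe, LinearMap.mem_ker, map_sub, sub_eq_zero]
    exact qtmk_bal b q g)

/-- comparison of the two models of the tensor product -/
noncomputable def cdEquiv : QT A Q (Q →ₗ[A] M) ≃ₗ[A] CounitDom k A Q M :=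
  LinearEquiv.ofLinearMap (qtLift (cdUnit k A Q M)) (cdInv k A Q M)
    (by
      refine LinearMap.ext fun z => ?_
      obtain ⟨z, rfl⟩ := Submodule.Quotient.mk_surjective _ z
      induction z with
      | zero => rw [Submodule.Quotient.mk_zero]; simp
      | tmul q g => 
        have : cdInv k A Q M (Submodule.Quotient.mk (q ⊗ₜ[k] g)) = qtmk q g := rfl
        rw [LinearMap.comp_apply, this, qtLift_mk]; rfl
      | add x y hx hy => rw [Submodule.Quotient.mk_add, map_add, hx, hy, map_add])
    (qt_hom_ext fun q g => by
      rw [LinearMap.comp_apply, qtLift_mk]; rfl)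

end CD

section Bridge

open CategoryTheory

variable {R : Type u} [Ring R]

lemma extMk_eq_zero_iff_zero {X Y : ModuleCat.{u} R} (P : ProjectiveResolution X)
    (f : P.complex.X 0 ⟶ Y) (hf : P.complex.d 1 0 ≫ f = 0) :
    P.extMk f 1 rfl hf = 0 ↔ f = 0 := by
  constructor
  · intro h
    rw [← P.extEquivCohomologyClass.apply_eq_iff_eq,
      ProjectiveResolution.extEquivCohomologyClass_extMk,
      ProjectiveResolution.extEquivCohomologyClass_zero,
      CochainComplex.HomComplex.CohomologyClass.mk_eq_zero_iff,
      CochainComplex.HomComplex.Cocycle.toSingleMk_mem_coboundaries_iff _ _ _ _ _ 1 (by simp)] at h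
    obtain ⟨g, hg⟩ := h
    have h0 : Limits.IsZero (P.cochainComplex.X 1) :=
      P.cochainComplex.isZero_of_isStrictlyLE 0 1 (by simp)
    rw [h0.eq_of_src g 0, Limits.comp_zero] at hg
    have := hg.symm
    rwa [Preadditive.IsIso.comp_left_eq_zero] at this
  · rintro rfl
    exact P.extMk_zero _ _

lemma extMk_eq_zero_iff_prev {X Y : ModuleCat.{u} R} (P : ProjectiveResolution X) (n p : ℕ)
    (hp : (ComplexShape.up ℕ).prev n = p)
    (f : P.complex.X n ⟶ Y) (hf : P.complex.d (n + 1) n ≫ f = 0) :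
    P.extMk f (n + 1) rfl hf = 0 ↔ ∃ g : P.complex.X p ⟶ Y, P.complex.d n p ≫ g = f := by
  rcases n with _ | n
  · simp only [CochainComplex.prev_nat_zero] at hp
    subst hp
    rw [extMk_eq_zero_iff_zero]
    simp [eq_comm]
  · simp only [CochainComplex.prev_nat_succ] at hp
    subst hp
    exact P.extMk_eq_zero_iff f _ _ hf n rfl

/-- cycles -/
def cyc {X : ModuleCat.{u} R} (P : ProjectiveResolution X) (Y : ModuleCat.{u} R) (n : ℕ) :
    AddSubgroup (P.complex.X n ⟶ Y) where
  carrier := {f | P.complex.d (n + 1) n ≫ f = 0}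
  zero_mem' := by simp
  add_mem' := by
    intro a b ha hb
    simp only [Set.mem_setOf_eq] at ha hb ⊢
    rw [Preadditive.comp_add, ha, hb, add_zero]
  neg_mem' := by
    intro a ha
    simp only [Set.mem_setOf_eq] at ha ⊢
    rw [Preadditive.comp_neg, ha, neg_zero]

/-- cycles to new Ext -/
noncomputable def cycToExt {X : ModuleCat.{u} R} (P : ProjectiveResolution X)
    (Y : ModuleCat.{u} R) (n : ℕ) : cyc P Y n →+ Abelian.Ext X Y n :=
  AddMonoidHom.mk' (fun f => P.extMk f.1 (n + 1) rfl f.2) fun f g =>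
    (P.add_extMk f.1 g.1 _ _ f.2 g.2).symm

lemma cyc_hom {X : ModuleCat.{u} R} (P : ProjectiveResolution X)
    (Y : ModuleCat.{u} R) (n p : ℕ) (hp : (ComplexShape.up ℕ).prev n = p) :
    ∃ φ : cyc P Y n →+ (P.complex.linearYonedaObj ℤ Y).homology n, Surjective φ ∧
      ∀ f, φ f = 0 ↔ ∃ g : P.complex.X p ⟶ Y, P.complex.d n p ≫ g = f.1 := by
  let K := P.complex.linearYonedaObj ℤ Y
  let S := K.sc' p n (n + 1)
  let e : K.homology n ≅ ModuleCat.of ℤ (LinearMap.ker S.g.hom ⧸ LinearMap.range S.moduleCatToCycles) :=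
    (K.homologyIsoSc' p n (n + 1) hp (by simp)) ≪≫ S.moduleCatHomologyIso
  let ψ : cyc P Y n →+ LinearMap.ker S.g.hom :=
    AddMonoidHom.mk' (fun f => ⟨f.1, f.2⟩) fun f g => rfl
  let mk : LinearMap.ker S.g.hom →ₗ[ℤ] (LinearMap.ker S.g.hom ⧸ LinearMap.range S.moduleCatToCycles) := Submodule.mkQ _
  refine ⟨(e.inv.hom ∘ₗ mk).toAddMonoidHom.comp ψ, ?_, ?_⟩
  · refine (e.toLinearEquiv.symm.surjective.comp (Submodule.mkQ_surjective _)).comp ?_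
    rintro ⟨f, hf⟩
    exact ⟨⟨f, hf⟩, rfl⟩
  · intro f
    have h1 : ((e.inv.hom ∘ₗ mk).toAddMonoidHom.comp ψ) f = 0 ↔ mk (ψ f) = 0 :=
      e.toLinearEquiv.symm.map_eq_zero_iff
    rw [h1]
    have h2 : mk (ψ f) = 0 ↔ ψ f ∈ LinearMap.range S.moduleCatToCycles :=
      Submodule.Quotient.mk_eq_zero _
    rw [h2]
    constructor
    · rintro ⟨g, hg⟩
      exact ⟨g, congrArg Subtype.val hg⟩
    · rintro ⟨g, hg⟩
      exact ⟨g, Subtype.ext hg⟩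

lemma equiv_of_surj {G H K : Type u} [AddCommGroup G] [AddCommGroup H] [AddCommGroup K]
    (φ : G →+ H) (ψ : G →+ K) (hφ : Surjective φ) (hψ : Surjective ψ)
    (h : ∀ g, φ g = 0 ↔ ψ g = 0) : Nonempty (H ≃+ K) := by
  have hk : φ.ker = ψ.ker := by ext g; exact h g
  exact ⟨(QuotientAddGroup.quotientKerEquivOfSurjective φ hφ).symm.trans
    ((QuotientAddGroup.quotientAddEquivOfEq hk).trans
      (QuotientAddGroup.quotientKerEquivOfSurjective ψ hψ))⟩

theorem ext_bridge (X Y : ModuleCat.{u} R) (n : ℕ) :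
    Nonempty ((((_root_.Ext ℤ (ModuleCat.{u} R) n).obj (Opposite.op X)).obj Y : Type u) ≃+
      Abelian.Ext X Y n) := by
  let P := ProjectiveResolution.of X
  obtain ⟨φ, hφ, hφ'⟩ := cyc_hom P Y n _ rfl
  obtain ⟨e⟩ := equiv_of_surj φ (cycToExt P Y n) hφ
    (fun α => by
      obtain ⟨f, hf, h⟩ := P.extMk_surjective α (n + 1) rfl
      exact ⟨⟨f, hf⟩, h⟩)
    (fun f => (hφ' f).trans (extMk_eq_zero_iff_prev P n _ rfl f.1 f.2).symm)
  exact ⟨(P.isoExt n Y).toLinearEquiv.toAddEquiv.trans e⟩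

end Bridge

section ExtSES

open CategoryTheory

/-- Ext groups of modules -/
abbrev ME (R : Type u) [Ring R] (N X : Type u) [AddCommGroup N] [Module R N] [AddCommGroup X]
    [Module R X] (n : ℕ) : Type u :=
  Abelian.Ext (ModuleCat.of R N) (ModuleCat.of R X) n

variable {R : Type u} [Ring R] {K F N : Type u} [AddCommGroup K] [Module R K]
  [AddCommGroup F] [Module R F] [AddCommGroup N] [Module R N]
  (X : Type u) [AddCommGroup X] [Module R X]
  (f : K →ₗ[R] F) (g : F →ₗ[R] N)

/-- Ext is invariant under isomorphisms -/
noncomputable def meCongr (e : K ≃ₗ[R] F) (n : ℕ) : ME R K X n ≃+ ME R F X n where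
  toFun x := (Abelian.Ext.mk₀ e.toModuleIso.inv).comp x (zero_add n)
  invFun x := (Abelian.Ext.mk₀ e.toModuleIso.hom).comp x (zero_add n)
  left_inv x := by
    dsimp only
    rw [Abelian.Ext.mk₀_comp_mk₀_assoc, Iso.hom_inv_id, Abelian.Ext.mk₀_id_comp]
  right_inv x := by
    dsimp only
    rw [Abelian.Ext.mk₀_comp_mk₀_assoc, Iso.inv_hom_id, Abelian.Ext.mk₀_id_comp]
  map_add' x y := by simp

/-- the equivalence in degree zero -/
noncomputable def meZero : ME R K X 0 ≃+ (K →ₗ[R] X) :=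
  Abelian.Ext.addEquiv₀.trans
    { toFun := fun f => f.hom
      invFun := fun f => ModuleCat.ofHom f
      left_inv := fun _ => rfl
      right_inv := fun _ => rfl
      map_add' := fun _ _ => rfl }

lemma me_free [Module.Free R F] (n : ℕ) : Subsingleton (ME R F X (n + 1)) := by
  have : Projective (ModuleCat.of R F) :=
    (IsProjective.iff_projective F).1 inferInstance
  exact Abelian.Ext.subsingleton_of_projective _ _ _

/-- short complex -/
abbrev sesC (hfg : LinearMap.ker g = LinearMap.range f) : ShortComplex (ModuleCat.{u} R) :=
  ModuleCat.shortComplexOfCompEqZero f g (by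
    ext x
    have : f x ∈ LinearMap.ker g := hfg ▸ ⟨x, rfl⟩
    exact this)

include f g in
lemma ses_short (hf : Injective f) (hfg : LinearMap.ker g = LinearMap.range f)
    (hg : Surjective g) : (sesC f g hfg).ShortExact :=
  ModuleCat.shortComplex_shortExact _ (LinearMap.exact_iff.2 hfg) hf hg

lemma ses_ext1 (hf : Injective f) (hfg : LinearMap.ker g = LinearMap.range f)
    (hg : Surjective g) (h1 : Subsingleton (ME R F X 1)) :
    ∃ φ : (K →ₗ[R] X) →+ ME R N X 1, Surjective φ ∧
      ∀ h, φ h = 0 ↔ ∃ t : F →ₗ[R] X, t ∘ₗ f = h := by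
  have hS := ses_short f g hf hfg hg
  let Φ : ME R K X 0 →+ ME R N X 1 := hS.extClass.precomp (ModuleCat.of R X) (add_zero 1)
  refine ⟨Φ.comp (meZero X).symm.toAddMonoidHom, ?_, ?_⟩
  · refine Surjective.comp (g := Φ) ?_ (meZero X).symm.surjective
    intro x
    obtain ⟨y, hy⟩ := Abelian.Ext.contravariant_sequence_exact₃ hS (ModuleCat.of R X) x
      (Subsingleton.elim (α := ME R F X 1) _ _) (add_zero 1)
    exact ⟨y, hy⟩
  · intro h
    constructor
    · intro h0
      obtain ⟨y, hy⟩ := Abelian.Ext.contravariant_sequence_exact₁ hS (ModuleCat.of R X)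
        ((meZero X).symm h) (add_zero 1) h0
      obtain ⟨t, rfl⟩ := (meZero (R := R) (K := F) X).symm.surjective y
      refine ⟨t, (meZero X).symm.injective ?_⟩
      rw [← hy]
      exact (Abelian.Ext.mk₀_comp_mk₀ (ModuleCat.ofHom f) (ModuleCat.ofHom t)).symm
    · rintro ⟨t, rfl⟩
      have : (meZero X).symm (t ∘ₗ f) =
          (Abelian.Ext.mk₀ (ModuleCat.ofHom f)).comp ((meZero X).symm t) (zero_add 0) :=
        (Abelian.Ext.mk₀_comp_mk₀ (ModuleCat.ofHom f) (ModuleCat.ofHom t)).symm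
      change hS.extClass.comp ((meZero X).symm (t ∘ₗ f)) (add_zero 1) = 0
      rw [this]
      exact hS.extClass_comp_assoc _

lemma ses_shift (hf : Injective f) (hfg : LinearMap.ker g = LinearMap.range f)
    (hg : Surjective g) (i : ℕ) (h1 : Subsingleton (ME R F X (i + 1)))
    (h2 : Subsingleton (ME R F X (i + 2))) :
    Nonempty (ME R K X (i + 1) ≃+ ME R N X (i + 2)) := by
  have hS := ses_short f g hf hfg hg
  let Φ : ME R K X (i + 1) →+ ME R N X (i + 2) :=
    hS.extClass.precomp (ModuleCat.of R X) (by lia)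
  refine ⟨AddEquiv.ofBijective Φ ⟨?_, ?_⟩⟩
  · rw [injective_iff_map_eq_zero]
    intro x hx
    obtain ⟨y, hy⟩ := Abelian.Ext.contravariant_sequence_exact₁ hS (ModuleCat.of R X)
        x (by lia) hx
    rw [← hy, Subsingleton.elim (α := ME R F X (i + 1)) y 0]
    simp
  · intro x
    obtain ⟨y, hy⟩ := Abelian.Ext.contravariant_sequence_exact₃ hS (ModuleCat.of R X) x
      (Subsingleton.elim (α := ME R F X (i + 2)) _ _) (n₀ := i + 1) (by lia)
    exact ⟨y, hy⟩

lemma mapRange_ses (I : Type u) (hf : Injective f) (hfg : LinearMap.ker g = LinearMap.range f)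
    (hg : Surjective g) :
    Injective (Finsupp.mapRange.linearMap (α := I) f) ∧
    LinearMap.ker (Finsupp.mapRange.linearMap (α := I) g) =
      LinearMap.range (Finsupp.mapRange.linearMap (α := I) f) ∧
    Surjective (Finsupp.mapRange.linearMap (α := I) g) := by
  refine ⟨Finsupp.mapRange_injective _ (map_zero f) hf, ?_, Finsupp.mapRange_surjective _ (map_zero g) hg⟩
  rw [Finsupp.ker_mapRange, Finsupp.range_mapRange_linearMap _ (LinearMap.ker_eq_bot.2 hf), hfg]

/-- the free presentation -/
noncomputable abbrev frp (R N : Type u) [Ring R] [AddCommGroup N] [Module R N] :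
    (N →₀ R) →ₗ[R] N :=
  Finsupp.linearCombination R (id : N → N)

lemma frp_surj (R N : Type u) [Ring R] [AddCommGroup N] [Module R N] : Surjective (frp R N) :=
  Finsupp.linearCombination_id_surjective R N

lemma frp_ker (R N : Type u) [Ring R] [AddCommGroup N] [Module R N] :
    ∃ (K : Type u) (_ : AddCommGroup K) (_ : Module R K) (f : K →ₗ[R] (N →₀ R)),
      Injective f ∧ LinearMap.ker (frp R N) = LinearMap.range f :=
  ⟨LinearMap.ker (frp R N), inferInstance, inferInstance,
    (LinearMap.ker (frp R N)).subtype, (LinearMap.ker (frp R N)).injective_subtype,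
    (Submodule.range_subtype _).symm⟩

lemma me_coprod (I : Type u) (i : ℕ) : ∀ (N : Type u) [AddCommGroup N] [Module R N],
    Subsingleton (ME R N X (i + 1)) → Subsingleton (ME R (I →₀ N) X (i + 1)) := by
  induction i with
  | zero =>
    intro N _ _ hN
    obtain ⟨K, _, _, f, hf, hfg⟩ := frp_ker R N
    obtain ⟨hf', hfg', hg'⟩ := mapRange_ses _ _ I hf hfg (frp_surj R N)
    obtain ⟨φ, -, hφ⟩ := ses_ext1 X _ _ hf hfg (frp_surj R N) (me_free X 0)
    obtain ⟨ψ, hψ, hψ'⟩ := ses_ext1 X _ _ hf' hfg' hg' (me_free X 0)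
    have hz : ∀ h, ψ h = 0 := by
      intro h
      rw [hψ']
      have := fun j : I => (hφ (h ∘ₗ Finsupp.lsingle j)).1 (Subsingleton.elim _ _)
      choose t ht using this
      refine ⟨Finsupp.lsum ℕ t, ?_⟩
      ext j x
      have := LinearMap.congr_fun (ht j) x
      simpa using this
    refine ⟨fun a b => ?_⟩
    obtain ⟨a, rfl⟩ := hψ a
    obtain ⟨b, rfl⟩ := hψ b
    rw [hz, hz]
  | succ i ih =>
    intro N _ _ hN
    obtain ⟨K, _, _, f, hf, hfg⟩ := frp_ker R N
    obtain ⟨hf', hfg', hg'⟩ := mapRange_ses _ _ I hf hfg (frp_surj R N)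
    obtain ⟨e⟩ := ses_shift X _ _ hf hfg (frp_surj R N) i (me_free X _) (me_free X _)
    obtain ⟨e'⟩ := ses_shift X _ _ hf' hfg' hg' i (me_free X _) (me_free X _)
    have := ih _ e.toEquiv.subsingleton
    exact e'.symm.toEquiv.subsingleton

end ExtSES

section Main

variable {A : Type u} [Ring A] {Q : Type u} [AddCommGroup Q] [Module A Q]
  (X : Type u) [AddCommGroup X] [Module A X]
  (k : ℕ → ℕ)
  (d : ∀ n, (Fin (k (n + 1)) → Module.End A Q) →ₗ[Module.End A Q] (Fin (k n) → Module.End A Q))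
  (ε : (Fin (k 0) → Module.End A Q) →ₗ[Module.End A Q] Q)

include k d ε in
theorem main_aux (hε : Surjective ε) (h0 : LinearMap.ker ε = LinearMap.range (d 0))
    (hd : ∀ n, LinearMap.ker (d n) = LinearMap.range (d (n + 1)))
    (hX : ∀ i, Subsingleton (ME A Q X (i + 1))) (i : ℕ) :
    ∀ (Y : Type u) [AddCommGroup Y] [Module (Module.End A Q)ᵐᵒᵖ Y],
      (∀ j, j + 1 ≤ i → ExAt Y (d j) (d (j + 1))) →
      Nonempty (ME A (QT A Q Y) X i ≃+ ME (Module.End A Q)ᵐᵒᵖ Y (Q →ₗ[A] X) i) := by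
  have hQF : ∀ (I : Type u) (i : ℕ),
      Subsingleton (ME A (QT A Q (I →₀ (Module.End A Q)ᵐᵒᵖ)) X (i + 1)) := by
    intro I i
    have := me_coprod X I i Q (hX i)
    exact (meCongr X (qtFree I) (i + 1)).toEquiv.subsingleton
  induction i with
  | zero =>
    intro Y _ _ _
    exact ⟨(meZero X).trans (qtAdj.trans (meZero (Q →ₗ[A] X)).symm)⟩
  | succ i ih =>
    intro Y _ _ hY
    obtain ⟨K, _, _, f, hf, hfg⟩ := frp_ker (Module.End A Q)ᵐᵒᵖ Y
    have hg := frp_surj (Module.End A Q)ᵐᵒᵖ Y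
    have hf' := qtMap_inj f _ hf hg hfg (d 0) (d 1) ε hε h0 (hd 0) (hY 0 (by lia))
    have hfg' := qtMap_exact f _ hg hfg
    have hg' := qtMap_surj _ hg
    rcases i with _ | i
    · obtain ⟨φ, hφ, hφ'⟩ := ses_ext1 X _ _ hf' hfg' hg' (hQF _ 0)
      obtain ⟨ψ, hψ, hψ'⟩ := ses_ext1 (Q →ₗ[A] X) _ _ hf hfg hg (me_free _ 0)
      refine equiv_of_surj φ (ψ.comp (qtAdj (A := A) (Q := Q) (Y := K) (X := X)).toAddMonoidHom) hφ
        (hψ.comp qtAdj.surjective) ?_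
      intro h
      rw [hφ', AddMonoidHom.comp_apply, hψ']
      constructor
      · rintro ⟨t, rfl⟩
        exact ⟨qtAdj t, (qtAdj_nat f t).symm⟩
      · rintro ⟨t, ht⟩
        obtain ⟨t, rfl⟩ := (qtAdj (A := A) (Q := Q) (X := X)).surjective t
        refine ⟨t, qtAdj.injective ?_⟩
        rw [qtAdj_nat]
        exact ht
    · obtain ⟨e₁⟩ := ses_shift X _ _ hf' hfg' hg' i (hQF _ _) (hQF _ _)
      obtain ⟨e₂⟩ := ses_shift (Q →ₗ[A] X) _ _ hf hfg hg i (me_free _ _) (me_free _ _)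
      obtain ⟨e₃⟩ := ih K (by
        intro j hj v hv
        have hv' : pm (Y →₀ (Module.End A Q)ᵐᵒᵖ) (d j) (fun l => f (v l)) = 0 := by
          rw [pm_nat, hv]
          ext1 l
          exact map_zero f
        obtain ⟨w, hw⟩ := exAt_free Y (d j) (d (j + 1)) (hd j) _ hv'
        refine exAt_shift f _ hf hg hfg (d (j + 1)) (d (j + 2)) ?_ (hY (j + 1) (by lia)) v w hw
        intro t
        have : d (j + 2) t ∈ LinearMap.ker (d (j + 1)) := by
          rw [hd (j + 1)]
          exact ⟨t, rfl⟩
        exact this)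
      exact ⟨e₁.symm.trans (e₃.trans e₂)⟩

end Main
end Stmt14Aux
section Stmt14

variable (k : Type u) [Field k]
variable (A : Type u) [Ring A] [Algebra k A] [Module.Finite k A]
variable (Q : Type u) [AddCommGroup Q] [Module k Q] [Module A Q]
  [IsScalarTower k A Q] [SMulCommClass A k Q] [SMulCommClass k A Q]
  [Module.Finite A Q]
variable (M : Type u) [AddCommGroup M] [Module k M] [Module A M]
  [IsScalarTower k A M] [SMulCommClass A k M] [SMulCommClass k A M]
  [Module.Finite A M]
variable (X : Type u) [AddCommGroup X] [Module k X] [Module A X]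
  [IsScalarTower k A X] [SMulCommClass A k X] [SMulCommClass k A X]

/-- Let `B = End_A(Q)ᵒᵖ`.  If `Tor_i^B(Q, Hom_A(Q,M)) = 0` for
`1 ≤ i ≤ q`, then for every `A`-module `X` with `Ext_A^{i>0}(Q, X) = 0` there are
isomorphisms `Ext_A^i(Q ⊗_B Hom_A(Q,M), X) ≅ Ext_B^i(Hom_A(Q,M), Hom_A(Q,X))`
for all `0 ≤ i ≤ q`.  (Left `B`-modules are realized as left
`End_A(Q)ᵐᵒᵖ`-modules, and the Tor group as `Tor_i` over `E = End_A(Q)` of the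
right `E`-module `Hom_A(Q,M)` with the left `E`-module `Q`.) -/
theorem stmt_14
    (q : ℕ)
    (hTor : TorVanishUpTo (Module.End A Q) (Q →ₗ[A] M) Q q)
    (hX : ∀ i, 0 < i → ExtVanish A (ModuleCat.of A Q) (ModuleCat.of A X) i) :
    ∀ i, i ≤ q →
      Nonempty
        ((((_root_.Ext ℤ (ModuleCat.{u} A) i).obj
            (Opposite.op (ModuleCat.of A (CounitDom k A Q M)))).obj
            (ModuleCat.of A X)) ≅
          (((_root_.Ext ℤ (ModuleCat.{u} (Module.End A Q)ᵐᵒᵖ) i).obj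
            (Opposite.op (ModuleCat.of (Module.End A Q)ᵐᵒᵖ (Q →ₗ[A] M)))).obj
            (ModuleCat.of (Module.End A Q)ᵐᵒᵖ (Q →ₗ[A] X)))) := by

  obtain ⟨k', d, ε, hε, h0, hd, hT⟩ := hTor
  intro i hi
  obtain ⟨e⟩ := Stmt14Aux.main_aux X k' d ε hε h0 hd
    (fun j => by
      obtain ⟨b⟩ := Stmt14Aux.ext_bridge (ModuleCat.of A Q) (ModuleCat.of A X) (j + 1)
      have hj : Subsingleton (((_root_.Ext ℤ (ModuleCat.{u} A) (j + 1)).obj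
        (Opposite.op (ModuleCat.of A Q))).obj (ModuleCat.of A X) : Type u) :=
        hX (j + 1) (Nat.succ_pos j)
      exact b.symm.toEquiv.subsingleton) i (Q →ₗ[A] M)
    (fun j hj v hv => hT j (le_trans hj hi) v hv)
  obtain ⟨b₁⟩ := Stmt14Aux.ext_bridge (ModuleCat.of A (CounitDom k A Q M)) (ModuleCat.of A X) i
  obtain ⟨b₂⟩ := Stmt14Aux.ext_bridge (ModuleCat.of (Module.End A Q)ᵐᵒᵖ (Q →ₗ[A] M))
    (ModuleCat.of (Module.End A Q)ᵐᵒᵖ (Q →ₗ[A] X)) i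
  let c := Stmt14Aux.meCongr X (Stmt14Aux.cdEquiv k A Q M) i
  exact ⟨(b₁.trans (c.symm.trans (e.trans b₂.symm))).toIntLinearEquiv.toModuleIso⟩

end Stmt14
end

section
/- Let R be a commutative Noetherian ring, A a projective Noetherian R-algebra, Q a finitely generated A-module projective over R with Hom_A(Q,Q) ≅ (via the natural algebra map) in place, DQ ⊗_A M ∈ R-proj and DQ ⊗_A Q projective over R. Suppose M is a finitely generated A-module projective over R such that Hom_A(M, Q) is projective over R and for every maximal ideal m of R the canonical map R(m) ⊗_R Hom_A(M, Q) → Hom_{A(m)}(M(m), Q(m)) is an isomorphism. Then Q-domdim_{(A,R)} M = inf { Q(m)-domdim_{A(m)} M(m) : m a maximal ideal of R }, where for any R-module X, X(m) = R/m ⊗_R X and A(m) = R/m ⊗_R A. -/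
universe u
open Function TensorProduct

open RelDom Function TensorProduct

section Stmt15

variable (R : Type u) [CommRing R] [IsNoetherianRing R]
variable (A : Type u) [Ring A] [Algebra R A] [Module.Finite R A] [Module.Projective R A]
variable (Q : Type u) [AddCommGroup Q] [Module R Q] [Module A Q]
  [IsScalarTower R A Q] [SMulCommClass A R Q] [SMulCommClass R A Q]
  [Module.Finite A Q] [Module.Projective R Q]
variable (M : Type u) [AddCommGroup M] [Module R M] [Module A M]
  [IsScalarTower R A M] [SMulCommClass A R M] [SMulCommClass R A M]
  [Module.Finite A M] [Module.Projective R M]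

/-- the `A`-submodule `I•X` of `X`, for an ideal `I` of `R` -/
def idealMul (I : Ideal R) (X : Type u) [AddCommGroup X] [Module R X] [Module A X]
    [IsScalarTower R A X] : Submodule A X :=
  Submodule.span A {x | ∃ (r : R) (y : X), r ∈ I ∧ x = r • y}

/-- the reduction mod `I` of a homomorphism, `Hom_A(M,Q) → Hom_{A(I)}(M(I), Q(I))` -/
noncomputable def redMap (I : Ideal R) (g : M →ₗ[A] Q) :
    (M ⧸ idealMul R A I M) →ₗ[A] (Q ⧸ idealMul R A I Q) :=
  Submodule.mapQ _ _ g (by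
    refine Submodule.span_le.mpr ?_
    rintro x ⟨r, y, hr, rfl⟩
    simp only [SetLike.mem_coe, Submodule.mem_comap]
    rw [LinearMap.map_smul_of_tower g r y]
    exact Submodule.subset_span ⟨r, g y, hr, rfl⟩)

end Stmt15

namespace RelDomAux

section Generic

variable {R : Type u} [CommRing R] {A : Type u} [Ring A] [Algebra R A]
variable {Q : Type u} [AddCommGroup Q] [Module A Q]

/-- every map to `Q` extends along `f` -/
def Approx (Q : Type u) [AddCommGroup Q] [Module A Q] {M T : Type u} [AddCommGroup M] [Module A M]
    [AddCommGroup T] [Module A T] (f : M →ₗ[A] T) : Prop :=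
  ∀ g : M →ₗ[A] Q, ∃ h : T →ₗ[A] Q, ∀ m, h (f m) = g m

lemma Approx.ext {M T S : Type u} [AddCommGroup M] [Module A M]
    [AddCommGroup T] [Module A T] [AddCommGroup S] [Module A S] {f : M →ₗ[A] T}
    (hf : Approx Q f) (hS : InAdd A Q S) (g : M →ₗ[A] S) :
    ∃ h : T →ₗ[A] S, ∀ m, h (f m) = g m := by
  obtain ⟨n, i, p, hip⟩ := hS
  choose h hh using fun j : Fin n => hf (LinearMap.proj j ∘ₗ i ∘ₗ g)
  refine ⟨p ∘ₗ LinearMap.pi h, fun m => ?_⟩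
  rw [← hip (g m)]
  simp only [LinearMap.comp_apply]
  congr 1
  ext j
  simp [hh]

lemma inAdd_pi (k : ℕ) : InAdd A Q (Fin k → Q) :=
  ⟨k, LinearMap.id, LinearMap.id, fun _ => rfl⟩

lemma inAdd_prod {S T : Type u} [AddCommGroup S] [Module A S] [AddCommGroup T] [Module A T]
    (hS : InAdd A Q S) (hT : InAdd A Q T) : InAdd A Q (S × T) := by
  obtain ⟨n, i, p, h⟩ := hS
  obtain ⟨n', i', p', h'⟩ := hT
  let e : (Fin (n + n') → Q) ≃ₗ[A] (Fin n → Q) × (Fin n' → Q) :=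
    (LinearEquiv.funCongrLeft A Q finSumFinEquiv).trans (LinearEquiv.sumArrowLequivProdArrow _ _ A Q)
  refine ⟨n + n', e.symm.toLinearMap ∘ₗ (i.prodMap i'), (p.prodMap p') ∘ₗ e.toLinearMap, ?_⟩
  rintro ⟨s, t⟩
  simp [h, h']

lemma domdimGE_congr (n : ℕ) {X Y : Type u} [AddCommGroup X] [Module A X]
    [AddCommGroup Y] [Module A Y] (e : X ≃ₗ[A] Y)
    (h : DomdimGE R A Q n (ModuleCat.of A X)) : DomdimGE R A Q n (ModuleCat.of A Y) := by
  cases n with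
  | zero => trivial
  | succ n =>
    obtain ⟨T, hT, f, ⟨hi, r, hr1, hr2⟩, ha, hc⟩ := h
    change X →ₗ[A] T at f
    refine ⟨T, hT, (f ∘ₗ e.symm.toLinearMap : Y →ₗ[A] T), ⟨hi.comp e.symm.injective,
      e.toLinearMap.toAddMonoidHom.comp r, ?_, ?_⟩, ?_, ?_⟩
    · intro s x
      change e (r _) = _ • e (r x)
      rw [hr1]; exact e.map_smul _ _
    · intro m
      change e (r (f (e.symm m))) = m
      rw [hr2]; exact e.apply_symm_apply m
    · intro g
      change Y →ₗ[A] Q at g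
      obtain ⟨h, hh⟩ := ha (g ∘ₗ e.toLinearMap : X →ₗ[A] Q)
      refine ⟨h, fun m => ?_⟩
      refine (hh (e.symm m)).trans ?_
      exact congrArg g (e.apply_symm_apply m)
    · have : LinearMap.range (f ∘ₗ e.symm.toLinearMap : Y →ₗ[A] T) = LinearMap.range f :=
        LinearMap.range_comp_of_range_eq_top _ (LinearEquiv.range e.symm)
      rw [this]; exact hc

lemma domdimGE_congr_iff (n : ℕ) {X Y : Type u} [AddCommGroup X] [Module A X]
    [AddCommGroup Y] [Module A Y] (e : X ≃ₗ[A] Y) :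
    DomdimGE R A Q n (ModuleCat.of A X) ↔ DomdimGE R A Q n (ModuleCat.of A Y) :=
  ⟨domdimGE_congr n e, domdimGE_congr n e.symm⟩

/-- quotients by equal kernels -/
lemma equiv_of_ker {S X Y : Type u} [AddCommGroup S] [Module A S] [AddCommGroup X] [Module A X]
    [AddCommGroup Y] [Module A Y] (f : S →ₗ[A] X) (g : S →ₗ[A] Y) (hf : Surjective f)
    (hg : Surjective g) (h : ∀ s, f s = 0 ↔ g s = 0) : Nonempty (X ≃ₗ[A] Y) := by
  have : LinearMap.ker f = LinearMap.ker g := by ext s; simpa using h s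
  exact ⟨((f.quotKerEquivOfSurjective hf).symm.trans (Submodule.quotEquivOfEq _ _ this)).trans
    (g.quotKerEquivOfSurjective hg)⟩

lemma domdimGE_prod (n : ℕ) {X T : Type u} [AddCommGroup X] [Module A X]
    [AddCommGroup T] [Module A T] (hT : InAdd A Q T)
    (h : DomdimGE R A Q n (ModuleCat.of A X)) : DomdimGE R A Q n (ModuleCat.of A (X × T)) := by
  cases n with
  | zero => trivial
  | succ n =>
    obtain ⟨S, hS, f, ⟨hi, r, hr1, hr2⟩, ha, hc⟩ := h
    change X →ₗ[A] S at f
    change S →+ X at r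
    change ∀ (s : R) (x : S), r (algebraMap R A s • x) = algebraMap R A s • r x at hr1
    change ∀ m : X, r (f m) = m at hr2
    change Injective f at hi
    change Approx Q f at ha
    let F : X × T →ₗ[A] S × T := f.prodMap LinearMap.id
    refine ⟨ModuleCat.of A (S × T), inAdd_prod hS hT, F,
      ⟨hi.prodMap injective_id, r.prodMap (AddMonoidHom.id T), ?_, ?_⟩, ?_, ?_⟩
    · rintro c ⟨s, t⟩
      exact Prod.ext (hr1 c s) rfl
    · rintro ⟨x, t⟩
      exact Prod.ext (hr2 x) rfl
    · intro g
      change X × T →ₗ[A] Q at g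
      obtain ⟨h, hh⟩ := ha (g ∘ₗ LinearMap.inl A X T)
      refine ⟨(h.coprod (g ∘ₗ LinearMap.inr A X T) : S × T →ₗ[A] Q), ?_⟩
      rintro ⟨x, t⟩
      change h (f x) + g (0, t) = g (x, t)
      rw [hh]
      change g (x, 0) + g (0, t) = g (x, t)
      rw [← map_add]; simp
    · obtain ⟨e⟩ := equiv_of_ker
        ((LinearMap.range f).mkQ ∘ₗ LinearMap.fst A S T) (LinearMap.range F).mkQ
        ((Submodule.mkQ_surjective _).comp Prod.fst_surjective) (Submodule.mkQ_surjective _) (by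
          rintro ⟨s, t⟩
          simp [F])
      exact domdimGE_congr n e hc

lemma domdimGE_of_prod (n : ℕ) {X T : Type u} [AddCommGroup X] [Module A X]
    [AddCommGroup T] [Module A T] (hT : InAdd A Q T)
    (h : DomdimGE R A Q n (ModuleCat.of A (X × T))) : DomdimGE R A Q n (ModuleCat.of A X) := by
  cases n with
  | zero => trivial
  | succ n =>
    obtain ⟨S, hS, f, ⟨hi, r, hr1, hr2⟩, ha, hc⟩ := h
    change X × T →ₗ[A] S at f
    change S →+ X × T at r
    change ∀ (s : R) (x : S), r (algebraMap R A s • x) = algebraMap R A s • r x at hr1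
    change ∀ m : X × T, r (f m) = m at hr2
    change Injective f at hi
    change Approx Q f at ha
    let F : X →ₗ[A] S := f ∘ₗ LinearMap.inl A X T
    refine ⟨S, hS, F, ⟨hi.comp LinearMap.inl_injective, (AddMonoidHom.fst X T).comp r, ?_, ?_⟩,
      ?_, ?_⟩
    · intro c s
      change (r _).1 = _ • (r s).1
      rw [hr1]; rfl
    · intro x
      change (r (f (x, 0))).1 = x
      rw [hr2]
    · intro g
      change X →ₗ[A] Q at g
      obtain ⟨h, hh⟩ := ha (g ∘ₗ LinearMap.fst A X T)
      exact ⟨h, fun x => hh (x, 0)⟩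
    · obtain ⟨p, hp⟩ := ha.ext hT (LinearMap.snd A X T)
      obtain ⟨e⟩ := equiv_of_ker (LinearMap.prod (LinearMap.range f).mkQ p)
        (LinearMap.range F).mkQ (by
          rintro ⟨y, t⟩
          obtain ⟨s, rfl⟩ := Submodule.mkQ_surjective _ y
          refine ⟨s + f (0, t - p s), Prod.ext ?_ ?_⟩
          · simp
          · simp [hp]) (Submodule.mkQ_surjective _) (by
          intro s
          simp only [LinearMap.prod_apply, Function.prod, Submodule.mkQ_apply, Prod.mk_eq_zero,
            Submodule.Quotient.mk_eq_zero, LinearMap.mem_range]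
          constructor
          · rintro ⟨⟨⟨x, t⟩, rfl⟩, h2⟩
            rw [hp] at h2
            simp only [LinearMap.snd_apply] at h2
            subst h2
            exact ⟨x, rfl⟩
          · rintro ⟨x, rfl⟩
            exact ⟨⟨(x, 0), rfl⟩, hp (x, 0)⟩)
      exact domdimGE_congr n e (domdimGE_prod n hT hc)

lemma coker_prod {M T T' : Type u} [AddCommGroup M] [Module A M]
    [AddCommGroup T] [Module A T] [AddCommGroup T'] [Module A T'] (f : M →ₗ[A] T)
    (f' : M →ₗ[A] T') (h : T →ₗ[A] T') (hh : ∀ m, h (f m) = f' m) :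
    Nonempty (((T ⧸ LinearMap.range f) × T') ≃ₗ[A] ((T × T') ⧸ LinearMap.range (f.prod f'))) := by
  refine equiv_of_ker (LinearMap.prod ((LinearMap.range f).mkQ ∘ₗ LinearMap.fst A T T')
    (LinearMap.snd A T T' - h ∘ₗ LinearMap.fst A T T')) (Submodule.mkQ _) ?_
    (Submodule.mkQ_surjective _) ?_
  · rintro ⟨y, t⟩
    obtain ⟨s, rfl⟩ := Submodule.mkQ_surjective _ y
    exact ⟨(s, t + h s), by simp⟩
  · rintro ⟨s, t⟩
    simp only [LinearMap.prod_apply, Function.prod, Submodule.mkQ_apply, Prod.mk_eq_zero,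
      Submodule.Quotient.mk_eq_zero, LinearMap.mem_range, LinearMap.comp_apply, LinearMap.sub_apply,
      LinearMap.fst_apply, LinearMap.snd_apply, Prod.mk.injEq]
    constructor
    · rintro ⟨⟨x, rfl⟩, h2⟩
      exact ⟨x, rfl, by rw [← hh, sub_eq_zero.mp h2]⟩
    · rintro ⟨x, rfl, rfl⟩
      exact ⟨⟨x, rfl⟩, by rw [hh, sub_self]⟩

lemma coker_swap {M T T' : Type u} [AddCommGroup M] [Module A M]
    [AddCommGroup T] [Module A T] [AddCommGroup T'] [Module A T'] (f : M →ₗ[A] T)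
    (f' : M →ₗ[A] T') :
    Nonempty (((T' × T) ⧸ LinearMap.range (f'.prod f)) ≃ₗ[A]
      ((T × T') ⧸ LinearMap.range (f.prod f'))) := by
  refine equiv_of_ker (Submodule.mkQ _) (Submodule.mkQ _ ∘ₗ (LinearEquiv.prodComm A T' T).toLinearMap)
    (Submodule.mkQ_surjective _)
    ((Submodule.mkQ_surjective _).comp (LinearEquiv.prodComm A T' T).surjective) ?_
  rintro ⟨s, t⟩
  simp [and_comm]

lemma domdimGE_succ_iff (n : ℕ) {M T : Type u} [AddCommGroup M] [Module A M]
    [AddCommGroup T] [Module A T] (hT : InAdd A Q T) (f : M →ₗ[A] T) (hf : Approx Q f) :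
    DomdimGE R A Q (n + 1) (ModuleCat.of A M) ↔
      RSplitMono R A f ∧ DomdimGE R A Q n (ModuleCat.of A (T ⧸ LinearMap.range f)) := by
  constructor
  · rintro ⟨S, hS, f', ⟨hi, r, hr1, hr2⟩, ha, hc⟩
    change M →ₗ[A] S at f'
    change S →+ M at r
    change ∀ (s : R) (x : S), r (algebraMap R A s • x) = algebraMap R A s • r x at hr1
    change ∀ m : M, r (f' m) = m at hr2
    change Approx Q f' at ha
    obtain ⟨h, hh⟩ := hf.ext hS f'
    obtain ⟨h', hh'⟩ := ha.ext hT f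
    have key : ∀ m, (r.comp h.toAddMonoidHom) (f m) = m := fun m => by
      change r (h (f m)) = m
      rw [hh, hr2]
    refine ⟨⟨LeftInverse.injective key, r.comp h.toAddMonoidHom, ?_, key⟩, ?_⟩
    · intro s x
      change r (h _) = _ • r (h x)
      rw [map_smul, hr1]
    · obtain ⟨e1⟩ := coker_prod f f' h hh
      obtain ⟨e2⟩ := coker_prod f' f h' hh'
      obtain ⟨e3⟩ := coker_swap f f'
      exact domdimGE_of_prod n hS (domdimGE_congr n ((e2.trans e3).trans e1.symm)
        (domdimGE_prod n hT hc))
  · rintro ⟨h1, h2⟩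
    exact ⟨ModuleCat.of A T, hT, f, h1, hf, h2⟩

lemma domdimGE_of_succ (n : ℕ) : ∀ M : ModuleCat.{u} A,
    DomdimGE R A Q (n + 1) M → DomdimGE R A Q n M := by
  induction n with
  | zero => intro M _; trivial
  | succ n ih =>
    rintro M ⟨S, hS, f', h1, h2, hc⟩
    exact ⟨S, hS, f', h1, h2, ih _ hc⟩

lemma domdimGE_mono {n m : ℕ} (hnm : n ≤ m) (M : ModuleCat.{u} A)
    (h : DomdimGE R A Q m M) : DomdimGE R A Q n M := by
  induction m, hnm using Nat.le_induction with
  | base => exact h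
  | succ k _ ih => exact ih (domdimGE_of_succ k M h)

lemma le_domdim_iff (n : ℕ) (M : ModuleCat.{u} A) :
    (n : ℕ∞) ≤ Domdim R A Q M ↔ DomdimGE R A Q n M := by
  constructor
  · intro h
    cases n with
    | zero => trivial
    | succ n =>
      have h' : (n : ℕ∞) < Domdim R A Q M :=
        lt_of_lt_of_le (by exact_mod_cast Nat.lt_succ_self n) h
      unfold Domdim at h'
      simp only [lt_iSup_iff] at h'
      obtain ⟨m, hm, hlt⟩ := h'
      exact domdimGE_mono (by exact_mod_cast hlt) M hm
  · intro h
    exact le_iSup₂_of_le n h le_rfl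

end Generic

section RLin

variable {R : Type u} [CommRing R]

lemma hom_mem_smul {P N : Type u} [AddCommGroup P] [Module R P] [AddCommGroup N] [Module R N]
    [Module.Finite R P] [Module.Projective R P] (I : Ideal R) (g : P →ₗ[R] N)
    (hg : ∀ x, g x ∈ I • (⊤ : Submodule R N)) : g ∈ I • (⊤ : Submodule R (P →ₗ[R] N)) := by
  obtain ⟨n, p, hp⟩ := Module.Finite.exists_fin' R P
  obtain ⟨i, hi⟩ := Module.projective_lifting_property p LinearMap.id hp
  have key : g = ∑ j : Fin n,
      LinearMap.smulRightₗ (LinearMap.proj j ∘ₗ i) (g (p (Pi.single j 1))) := by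
    ext x
    have h1 : x = p (i x) := (LinearMap.congr_fun hi x).symm
    have h2 : i x = ∑ j : Fin n, (i x j) • (Pi.single j (1 : R) : Fin n → R) := by
      ext l; simp [Finset.sum_apply, Pi.single_apply]
    conv_lhs => rw [h1, h2]
    simp [map_sum, LinearMap.sum_apply]
  rw [key]
  refine Submodule.sum_mem _ fun j _ => ?_
  exact Submodule.smul_top_le_comap_smul_top I
    (LinearMap.smulRightₗ (LinearMap.proj j ∘ₗ i) : N →ₗ[R] (P →ₗ[R] N)) (hg _)

lemma exists_retraction [IsNoetherianRing R] {M N : Type u} [AddCommGroup M] [Module R M] [AddCommGroup N] [Module R N]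
    [Module.Finite R M] [Module.Projective R M] [Module.Projective R N] (f : M →ₗ[R] N)
    (hf : ∀ I : Ideal R, I.IsMaximal → ∀ x, f x ∈ I • (⊤ : Submodule R N) →
      x ∈ I • (⊤ : Submodule R M)) : ∃ r : N →ₗ[R] M, ∀ x, r (f x) = x := by
  let S : Submodule R (M →ₗ[R] M) := LinearMap.range (LinearMap.lcomp R M f)
  let J : Ideal R := S.comap (LinearMap.toSpanSingleton R (M →ₗ[R] M) LinearMap.id)
  have hJ : J = ⊤ := by
    by_contra hne
    obtain ⟨I, hI, hJI⟩ := Ideal.exists_le_maximal J hne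
    have hle : (⊤ : Submodule R (M →ₗ[R] M)) ≤ S ⊔ I • ⊤ := by
      intro g _
      let _ := Ideal.Quotient.field I
      let fb : (M ⧸ I • (⊤ : Submodule R M)) →ₗ[R] (N ⧸ I • (⊤ : Submodule R N)) :=
        Submodule.mapQ _ _ f (Submodule.smul_top_le_comap_smul_top I f)
      let fK : (M ⧸ I • (⊤ : Submodule R M)) →ₗ[R ⧸ I] (N ⧸ I • (⊤ : Submodule R N)) :=
        LinearMap.extendScalarsOfSurjective Ideal.Quotient.mk_surjective fb
      have hker : LinearMap.ker fK = ⊥ := by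
        rw [LinearMap.ker_eq_bot']
        intro y hy
        obtain ⟨x, rfl⟩ := Submodule.mkQ_surjective _ y
        have : (Submodule.Quotient.mk (f x) : N ⧸ I • (⊤ : Submodule R N)) = 0 := hy
        rw [Submodule.Quotient.mk_eq_zero] at this
        exact (Submodule.Quotient.mk_eq_zero _).2 (hf I hI x this)
      obtain ⟨l, hl⟩ := LinearMap.exists_leftInverse_of_injective fK hker
      obtain ⟨l', hl'⟩ := Module.projective_lifting_property
        (I • (⊤ : Submodule R M)).mkQ
        ((l.restrictScalars R) ∘ₗ (I • (⊤ : Submodule R N)).mkQ) (Submodule.mkQ_surjective _)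
      have h1 : ∀ x, x - l' (f x) ∈ I • (⊤ : Submodule R M) := by
        intro x
        rw [← Submodule.Quotient.mk_eq_zero, Submodule.Quotient.mk_sub, sub_eq_zero]
        have a := LinearMap.congr_fun hl' (f x)
        have b := LinearMap.congr_fun hl (Submodule.Quotient.mk x)
        exact (a.trans b).symm
      have h2 : g - g ∘ₗ l' ∘ₗ f ∈ I • (⊤ : Submodule R (M →ₗ[R] M)) := by
        refine hom_mem_smul I _ fun x => ?_
        have : (g - g ∘ₗ l' ∘ₗ f) x = g (x - l' (f x)) := by simp
        rw [this]
        exact Submodule.smul_top_le_comap_smul_top I g (h1 x)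
      have h3 : g = g ∘ₗ l' ∘ₗ f + (g - g ∘ₗ l' ∘ₗ f) := by abel
      rw [h3]
      exact Submodule.add_mem_sup ⟨g ∘ₗ l', rfl⟩ h2
    obtain ⟨r, hr1, hr2⟩ := Submodule.exists_sub_one_mem_and_smul_le_of_fg_of_le_sup
      (IsNoetherian.noetherian (R := R) (M := M →ₗ[R] M) ⊤) le_rfl hle
    have hrJ : r ∈ J := by
      change r • LinearMap.id ∈ S
      exact hr2 (Submodule.smul_mem_pointwise_smul _ _ _ trivial)
    have : (1 : R) ∈ I := by
      have := I.sub_mem (hJI hrJ) hr1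
      simpa using this
    exact hI.ne_top ((Ideal.eq_top_iff_one I).2 this)
  have h1 : (1 : R) ∈ J := by rw [hJ]; trivial
  change (1 : R) • LinearMap.id ∈ S at h1
  rw [one_smul] at h1
  obtain ⟨r, hr⟩ := h1
  exact ⟨r, fun x => LinearMap.congr_fun hr x⟩

end RLin

section Base

variable {R : Type u} [CommRing R] {A : Type u} [Ring A] [Algebra R A]

lemma mem_idealMul {X : Type u} [AddCommGroup X] [Module R X] [Module A X] [IsScalarTower R A X]
    (I : Ideal R) (x : X) : x ∈ idealMul R A I X ↔ x ∈ I • (⊤ : Submodule R X) := by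
  constructor
  · intro h
    refine Submodule.span_induction (p := fun x _ => x ∈ I • (⊤ : Submodule R X)) ?_ ?_ ?_ ?_ h
    · rintro x ⟨r, y, hr, rfl⟩
      exact Submodule.smul_mem_smul hr trivial
    · exact Submodule.zero_mem _
    · intro x y _ _ hx hy
      exact Submodule.add_mem _ hx hy
    · intro a x _ hx
      refine Submodule.smul_induction_on hx ?_ ?_
      · intro r hr n _
        rw [smul_comm]
        exact Submodule.smul_mem_smul hr trivial
      · intro x y hx hy
        rw [smul_add]
        exact Submodule.add_mem _ hx hy
  · intro h
    refine Submodule.smul_induction_on h ?_ ?_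
    · intro r hr n _
      exact Submodule.subset_span ⟨r, n, hr, rfl⟩
    · intro x y hx hy
      exact Submodule.add_mem _ hx hy

lemma map_idealMul {X Y : Type u} [AddCommGroup X] [Module R X] [Module A X] [IsScalarTower R A X]
    [AddCommGroup Y] [Module R Y] [Module A Y] [IsScalarTower R A Y]
    (I : Ideal R) (g : X →ₗ[R] Y) {x : X} (hx : x ∈ idealMul R A I X) :
    g x ∈ idealMul R A I Y := by
  rw [mem_idealMul] at hx ⊢
  exact Submodule.smul_top_le_comap_smul_top I g hx

/-- for `A`-linear maps -/
lemma map_idealMul' {X Y : Type u} [AddCommGroup X] [Module R X] [Module A X] [IsScalarTower R A X]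
    [AddCommGroup Y] [Module R Y] [Module A Y] [IsScalarTower R A Y]
    (I : Ideal R) (g : X →ₗ[A] Y) {x : X} (hx : x ∈ idealMul R A I X) :
    g x ∈ idealMul R A I Y := map_idealMul I (g.restrictScalars R) hx

lemma rsplit_iff {M N : Type u} [AddCommGroup M] [Module R M] [Module A M] [IsScalarTower R A M]
    [AddCommGroup N] [Module R N] [Module A N] [IsScalarTower R A N] (f : M →ₗ[A] N) :
    RSplitMono R A f ↔ ∃ r : N →ₗ[R] M, ∀ m, r (f m) = m := by
  constructor
  · rintro ⟨_, r, h1, h2⟩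
    exact ⟨{ r with map_smul' := fun c x => by simpa [algebraMap_smul] using h1 c x }, h2⟩
  · rintro ⟨r, hr⟩
    exact ⟨LeftInverse.injective hr, r.toAddMonoidHom, fun s x => by
      simp [algebraMap_smul], hr⟩

end Base

section GoodSec

variable (R : Type u) [CommRing R] (A : Type u) [Ring A] [Algebra R A]
variable (Q : Type u) [AddCommGroup Q] [Module R Q] [Module A Q] [IsScalarTower R A Q]

/-- the hypotheses on `M` carried along the induction -/
structure Good (M : Type u) [AddCommGroup M] [Module R M] [Module A M] [IsScalarTower R A M] :
    Prop where
  fin : Module.Finite R M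
  proj : Module.Projective R M
  homproj : Module.Projective R (M →ₗ[A] Q)
  surj : ∀ I : Ideal R, I.IsMaximal →
    ∀ g : (M ⧸ idealMul R A I M) →ₗ[A] (Q ⧸ idealMul R A I Q), ∃ g' : M →ₗ[A] Q,
      ∀ x, g (Submodule.Quotient.mk x) = Submodule.Quotient.mk (g' x)
  inj : ∀ I : Ideal R, I.IsMaximal → ∀ g : M →ₗ[A] Q, (∀ x, g x ∈ idealMul R A I Q) →
    g ∈ I • (⊤ : Submodule R (M →ₗ[A] Q))

variable {R A Q}

lemma mem_smul_of_dual {P : Type u} [AddCommGroup P] [Module R P]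
    [Module.Finite R P] [Module.Projective R P] (I : Ideal R) (y : P)
    (hy : ∀ φ : P →ₗ[R] R, φ y ∈ I) : y ∈ I • (⊤ : Submodule R P) := by
  obtain ⟨n, p, hp⟩ := Module.Finite.exists_fin' R P
  obtain ⟨i, hi⟩ := Module.projective_lifting_property p LinearMap.id hp
  have h1 : y = p (i y) := (LinearMap.congr_fun hi y).symm
  have h2 : i y = ∑ j : Fin n, (i y j) • (Pi.single j (1 : R) : Fin n → R) := by
    ext l; simp [Finset.sum_apply, Pi.single_apply]
  rw [h1, h2, map_sum]
  refine Submodule.sum_mem _ fun j _ => ?_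
  rw [map_smul]
  exact Submodule.smul_mem_smul (hy (LinearMap.proj j ∘ₗ i)) trivial

lemma eq_of_dual {P : Type u} [AddCommGroup P] [Module R P]
    [Module.Finite R P] [Module.Projective R P] {y z : P}
    (hy : ∀ φ : P →ₗ[R] R, φ y = φ z) : y = z := by
  apply (Module.evalEquiv R P).injective
  ext φ
  exact hy φ

lemma lift_tensorOver {N : Type u} [AddCommGroup N] [Module R N]
    (b : (Q →ₗ[R] R) →ₗ[R] Q →ₗ[R] N)
    (hb : ∀ φ (a : A) x, b (MulOpposite.op a • φ) x = b φ (a • x)) :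
    ∃ θ : TensorOver R A (Q →ₗ[R] R) Q →ₗ[R] N,
      ∀ φ x, θ (Submodule.Quotient.mk (φ ⊗ₜ[R] x)) = b φ x := by
  refine ⟨Submodule.liftQ _ (TensorProduct.lift b) (Submodule.span_le.2 ?_), fun φ x => ?_⟩
  · rintro z ⟨φ, a, x, rfl⟩
    simp [hb]
  · simp

lemma tensorOver_induction (p : TensorOver R A (Q →ₗ[R] R) Q → Prop)
    (h0 : p 0) (hadd : ∀ x y, p x → p y → p (x + y))
    (h : ∀ φ x, p (Submodule.Quotient.mk (φ ⊗ₜ[R] x))) : ∀ w, p w := by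
  intro w
  obtain ⟨z, rfl⟩ := Submodule.mkQ_surjective _ w
  induction z using TensorProduct.induction_on with
  | zero => simpa using h0
  | tmul φ x => exact h φ x
  | add x y hx hy => rw [map_add]; exact hadd _ _ hx hy

lemma tens_bal (φ : Q →ₗ[R] R) (a : A) (x : Q) :
    (Submodule.Quotient.mk (φ ⊗ₜ[R] (a • x)) : TensorOver R A (Q →ₗ[R] R) Q) =
      Submodule.Quotient.mk ((MulOpposite.op a • φ) ⊗ₜ[R] x) := by
  symm
  rw [← sub_eq_zero, ← Submodule.Quotient.mk_sub, Submodule.Quotient.mk_eq_zero]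
  exact Submodule.subset_span ⟨φ, a, x, rfl⟩

lemma exists_theta [Module.Finite R Q] [Module.Projective R Q] :
    ∃ Θ : (TensorOver R A (Q →ₗ[R] R) Q →ₗ[R] R) →ₗ[R] (Q →ₗ[A] Q),
      ∀ (θ : TensorOver R A (Q →ₗ[R] R) Q →ₗ[R] R) (φ : Q →ₗ[R] R) (x : Q), φ (Θ θ x) = θ (Submodule.Quotient.mk (φ ⊗ₜ[R] x)) := by
  let F : (TensorOver R A (Q →ₗ[R] R) Q →ₗ[R] R) → Q → Q := fun θ x =>
    (Module.evalEquiv R Q).symm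
      ((θ ∘ₗ Submodule.mkQ _) ∘ₗ (TensorProduct.mk R (Q →ₗ[R] R) Q).flip x)
  have hF : ∀ θ (φ : Q →ₗ[R] R) x, φ (F θ x) = θ (Submodule.Quotient.mk (φ ⊗ₜ[R] x)) := by
    intro θ φ x
    exact Module.apply_evalEquiv_symm_apply R Q φ _
  refine ⟨{ toFun := fun θ => { toFun := F θ, map_add' := ?_, map_smul' := ?_ },
            map_add' := ?_, map_smul' := ?_ }, hF⟩
  · intro x y
    refine eq_of_dual (R := R) fun φ => ?_
    rw [map_add, hF, hF, hF, TensorProduct.tmul_add, Submodule.Quotient.mk_add, map_add]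
  · intro a x
    refine eq_of_dual (R := R) fun φ => ?_
    rw [hF, tens_bal, ← hF]
    rfl
  · intro θ θ'
    ext x
    refine eq_of_dual (R := R) fun φ => ?_
    simp [hF]
  · intro c θ
    ext x
    refine eq_of_dual (R := R) fun φ => ?_
    simp [hF]

lemma good_self [Module.Finite R Q] [Module.Projective R Q]
    (hW : Module.Projective R (TensorOver R A (Q →ₗ[R] R) Q)) : Good R A Q Q := by
  obtain ⟨Θ, hΘ⟩ := exists_theta (R := R) (A := A) (Q := Q)
  have hinj : Injective Θ := by
    rw [← LinearMap.ker_eq_bot, LinearMap.ker_eq_bot']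
    intro θ hθ
    refine LinearMap.ext fun w => ?_
    induction w using tensorOver_induction with
    | h0 => simp
    | hadd x y hx hy => rw [map_add, hx, hy]; simp
    | h φ x => rw [← hΘ, hθ]; simp
  have hsurj : Surjective Θ := by
    intro g
    obtain ⟨θ, hθ⟩ := lift_tensorOver (A := A)
      (LinearMap.mk₂ R (fun (φ : Q →ₗ[R] R) (x : Q) => φ (g x)) (by simp) (by simp) (by simp)
        (by intro c φ x; simp [LinearMap.map_smul_of_tower g c x]))
      (by intro φ a x; simp [dual_smul_apply])
    refine ⟨θ, ?_⟩
    ext x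
    refine eq_of_dual (R := R) fun φ => ?_
    rw [hΘ, hθ]; rfl
  have hWfin : Module.Finite R (TensorOver R A (Q →ₗ[R] R) Q) := inferInstance
  refine ⟨inferInstance, inferInstance, ?_, ?_, ?_⟩
  · exact Module.Projective.of_equiv (LinearEquiv.ofBijective Θ ⟨hinj, hsurj⟩)
  · intro I hI g
    let π : Q →ₗ[R] (Q ⧸ idealMul R A I Q) := (idealMul R A I Q).mkQ.restrictScalars R
    have hπ : Surjective π := Submodule.mkQ_surjective (idealMul R A I Q)
    obtain ⟨G, hG⟩ := Module.projective_lifting_property π (g.restrictScalars R ∘ₗ π) hπ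
    have hG' : ∀ x, g (Submodule.Quotient.mk x) = Submodule.Quotient.mk (G x) :=
      fun x => (LinearMap.congr_fun hG x).symm
    obtain ⟨θ, hθ⟩ := lift_tensorOver (A := A) (N := R ⧸ I)
      (LinearMap.mk₂ R (fun (φ : Q →ₗ[R] R) (x : Q) => Submodule.mkQ I (φ (G x)))
        (by intros; simp) (by intro c φ x; rw [← map_smul]; rfl) (by intros; simp)
        (by intro c φ x; rw [← map_smul, ← map_smul, ← map_smul]))
      (by
        intro φ a x
        change Submodule.mkQ I (φ (a • G x)) = Submodule.mkQ I (φ (G (a • x)))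
        rw [← sub_eq_zero, ← map_sub, ← map_sub]
        refine (Submodule.Quotient.mk_eq_zero _).2 ?_
        have : a • G x - G (a • x) ∈ idealMul R A I Q := by
          rw [← Submodule.Quotient.mk_eq_zero, Submodule.Quotient.mk_sub,
            Submodule.Quotient.mk_smul, ← hG', ← hG', Submodule.Quotient.mk_smul, map_smul,
            sub_self]
        rw [mem_idealMul] at this
        have := Submodule.smul_top_le_comap_smul_top I φ this
        simpa using this)
    obtain ⟨θ', hθ'⟩ := Module.projective_lifting_property (Submodule.mkQ I) θ
      (Submodule.mkQ_surjective _)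
    refine ⟨Θ θ', fun x => ?_⟩
    rw [hG', ← sub_eq_zero, ← Submodule.Quotient.mk_sub, Submodule.Quotient.mk_eq_zero,
      mem_idealMul]
    refine mem_smul_of_dual I _ fun φ => ?_
    rw [← Submodule.Quotient.mk_eq_zero I, map_sub, hΘ, Submodule.Quotient.mk_sub, sub_eq_zero]
    have h1 := LinearMap.congr_fun hθ' (Submodule.Quotient.mk (φ ⊗ₜ[R] x))
    rw [hθ] at h1
    exact h1.symm
  · intro I hI g hg
    obtain ⟨θ, rfl⟩ := hsurj g
    have hθ : θ ∈ I • (⊤ : Submodule R (TensorOver R A (Q →ₗ[R] R) Q →ₗ[R] R)) := by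
      refine hom_mem_smul I θ fun w => ?_
      induction w using tensorOver_induction with
      | h0 => simp
      | hadd x y hx hy => rw [map_add]; exact Submodule.add_mem _ hx hy
      | h φ x =>
        rw [← hΘ]
        exact Submodule.smul_top_le_comap_smul_top I φ ((mem_idealMul I _).1 (hg x))
    exact Submodule.smul_top_le_comap_smul_top I Θ hθ

end GoodSec

section Coker

variable {R : Type u} [CommRing R] {A : Type u} [Ring A] [Algebra R A]
variable {Q : Type u} [AddCommGroup Q] [Module R Q] [Module A Q] [IsScalarTower R A Q]
variable {M : Type u} [AddCommGroup M] [Module R M] [Module A M] [IsScalarTower R A M]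

lemma sum_single (k : ℕ) (v : Fin k → Q) :
    v = ∑ j : Fin k, (LinearMap.single A (fun _ : Fin k => Q) j) (v j) := by
  ext l; simp [Finset.sum_apply, Pi.single_apply]

lemma mem_idealMul_pi (I : Ideal R) (k : ℕ) (v : Fin k → Q) :
    v ∈ idealMul R A I (Fin k → Q) ↔ ∀ j, v j ∈ idealMul R A I Q := by
  constructor
  · intro h j
    exact map_idealMul' I (LinearMap.proj j : (Fin k → Q) →ₗ[A] Q) h
  · intro h
    rw [sum_single (A := A) k v]
    exact Submodule.sum_mem _ fun j _ => map_idealMul' I _ (h j)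

lemma pi_proj (k : ℕ) (X : Type u) [AddCommGroup X] [Module R X] [Module.Projective R X] :
    Module.Projective R (Fin k → X) :=
  Module.Projective.of_equiv (DFinsupp.linearEquivFunOnFintype (R := R) (M := fun _ : Fin k => X))

lemma hom_pi_proj (hQ : Good R A Q Q) (k : ℕ) : Module.Projective R ((Fin k → Q) →ₗ[A] Q) := by
  have := hQ.homproj
  have := pi_proj (R := R) k (Q →ₗ[A] Q)
  exact Module.Projective.of_equiv
    (LinearMap.lsum A (fun _ : Fin k => Q) R : (Fin k → Q →ₗ[A] Q) ≃ₗ[R] _)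

lemma hom_pi_inj (hQ : Good R A Q Q) (k : ℕ) (I : Ideal R) (hI : I.IsMaximal)
    (g : (Fin k → Q) →ₗ[A] Q) (hg : ∀ x, g x ∈ idealMul R A I Q) :
    g ∈ I • (⊤ : Submodule R ((Fin k → Q) →ₗ[A] Q)) := by
  have key : g = ∑ j : Fin k, LinearMap.lcomp R Q (LinearMap.proj j : (Fin k → Q) →ₗ[A] Q)
      (g ∘ₗ LinearMap.single A (fun _ : Fin k => Q) j) := by
    refine LinearMap.ext fun v => ?_
    conv_lhs => rw [sum_single (A := A) k v, map_sum]
    simp [LinearMap.sum_apply]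
  rw [key]
  refine Submodule.sum_mem _ fun j _ => ?_
  exact Submodule.smul_top_le_comap_smul_top I _ (hQ.inj I hI _ fun x => hg _)

lemma hom_pi_surj (hQ : Good R A Q Q) (k : ℕ) (I : Ideal R) (hI : I.IsMaximal)
    (g : (Fin k → Q) →ₗ[A] (Q ⧸ idealMul R A I Q))
    (hg : ∀ x ∈ idealMul R A I (Fin k → Q), g x = 0) :
    ∃ g' : (Fin k → Q) →ₗ[A] Q, ∀ x, g x = Submodule.Quotient.mk (g' x) := by
  choose G hG using fun j : Fin k => hQ.surj I hI
    (Submodule.liftQ (idealMul R A I Q) (g ∘ₗ LinearMap.single A (fun _ : Fin k => Q) j)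
      (fun x hx => hg _ (map_idealMul' I _ hx)))
  refine ⟨∑ j : Fin k, G j ∘ₗ LinearMap.proj j, fun v => ?_⟩
  conv_lhs => rw [sum_single (A := A) k v, map_sum]
  rw [LinearMap.sum_apply]
  change _ = Submodule.mkQ _ (∑ j, _)
  rw [map_sum]
  exact Finset.sum_congr rfl fun j _ => hG j (v j)

lemma coker_proj {N : Type u} [AddCommGroup N] [Module R N] [Module A N] [IsScalarTower R A N]
    [Module.Projective R N] (f : M →ₗ[A] N) (r : N →ₗ[R] M) (hr : ∀ m, r (f m) = m) :
    Module.Projective R (N ⧸ LinearMap.range f) := by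
  let e : N →ₗ[R] N := LinearMap.id - f.restrictScalars R ∘ₗ r
  have he : (LinearMap.range f).restrictScalars R ≤ LinearMap.ker e := by
    rintro _ ⟨m, rfl⟩
    simp [e, hr]
  let s : (N ⧸ (LinearMap.range f).restrictScalars R) →ₗ[R] N :=
    Submodule.liftQ ((LinearMap.range f).restrictScalars R) e he
  have h : Module.Projective R (N ⧸ (LinearMap.range f).restrictScalars R) := by
    refine Module.Projective.of_split s (Submodule.mkQ _) ?_
    apply Submodule.linearMap_qext
    refine LinearMap.ext fun v => ?_
    change Submodule.mkQ _ (v - f (r v)) = Submodule.mkQ _ v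
    rw [map_sub, sub_eq_self]
    exact (Submodule.Quotient.mk_eq_zero _).2 ⟨r v, rfl⟩
  exact Module.Projective.of_equiv (Submodule.Quotient.restrictScalarsEquiv R (LinearMap.range f))

lemma good_coker (hQ : Good R A Q Q) (hM : Good R A Q M) (k : ℕ) (f : M →ₗ[A] (Fin k → Q))
    (hf : Approx Q f) (hs : RSplitMono R A f) :
    Good R A Q ((Fin k → Q) ⧸ LinearMap.range f) := by
  obtain ⟨r, hr⟩ := (rsplit_iff f).1 hs
  have := hQ.fin
  have := hQ.proj
  have := pi_proj (R := R) k Q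
  have := hM.homproj
  have := hom_pi_proj hQ k
  let π : (Fin k → Q) →ₗ[A] ((Fin k → Q) ⧸ LinearMap.range f) := (LinearMap.range f).mkQ
  have hπ : Surjective π := Submodule.mkQ_surjective _
  have hπ0 : ∀ m, π (f m) = 0 := fun m => by simp [π]
  -- splitting of restriction along `f`
  let ρ : ((Fin k → Q) →ₗ[A] Q) →ₗ[R] (M →ₗ[A] Q) := LinearMap.lcomp R Q f
  have hρ : Surjective ρ := fun g => by
    obtain ⟨h, hh⟩ := hf g
    exact ⟨h, LinearMap.ext hh⟩
  obtain ⟨σ, hσ⟩ := Module.projective_lifting_property ρ LinearMap.id hρ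
  have hσ' : ∀ g m, σ g (f m) = g m := fun g m =>
    LinearMap.congr_fun (LinearMap.congr_fun hσ g) m
  let ι : (((Fin k → Q) ⧸ LinearMap.range f) →ₗ[A] Q) →ₗ[R] ((Fin k → Q) →ₗ[A] Q) :=
    LinearMap.lcomp R Q π
  have hκ0 : ∀ h : (Fin k → Q) →ₗ[A] Q,
      LinearMap.range f ≤ LinearMap.ker (h - σ (ρ h)) := by
    rintro h _ ⟨m, rfl⟩
    simp only [LinearMap.mem_ker, LinearMap.sub_apply, hσ']
    exact sub_self _
  let κ : ((Fin k → Q) →ₗ[A] Q) →ₗ[R] (((Fin k → Q) ⧸ LinearMap.range f) →ₗ[A] Q) :=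
    { toFun := fun h => Submodule.liftQ _ (h - σ (ρ h)) (hκ0 h)
      map_add' := fun h h' => by
        apply Submodule.linearMap_qext
        refine LinearMap.ext fun v => ?_
        change (h + h' - σ (ρ (h + h'))) v = (h - σ (ρ h)) v + (h' - σ (ρ h')) v
        simp only [map_add, LinearMap.add_apply, LinearMap.sub_apply]
        abel
      map_smul' := fun c h => by
        apply Submodule.linearMap_qext
        refine LinearMap.ext fun v => ?_
        change (c • h - σ (ρ (c • h))) v = c • (h - σ (ρ h)) v
        simp only [map_smul, LinearMap.smul_apply, LinearMap.sub_apply, smul_sub] }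
  have hκι : ∀ g, κ (ι g) = g := by
    intro g
    have h0 : ρ (ι g) = 0 := by
      ext m
      change g (π (f m)) = 0
      rw [hπ0, map_zero]
    apply Submodule.linearMap_qext
    refine LinearMap.ext fun v => ?_
    change (ι g - σ (ρ (ι g))) v = g (π v)
    rw [h0, map_zero, sub_zero]; rfl
  refine ⟨?_, ?_, ?_, ?_, ?_⟩
  · exact Module.Finite.of_surjective (π.restrictScalars R) hπ
  · exact coker_proj f r hr
  · exact Module.Projective.of_split ι κ (LinearMap.ext hκι)
  · intro I hI g
    obtain ⟨h, hh⟩ := hom_pi_surj hQ k I hI (g ∘ₗ Submodule.mkQ _ ∘ₗ π) (by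
      intro x hx
      have : (Submodule.mkQ (idealMul R A I ((Fin k → Q) ⧸ LinearMap.range f))) (π x) = 0 :=
        (Submodule.Quotient.mk_eq_zero _).2 (map_idealMul' I π hx)
      simp only [LinearMap.comp_apply, this, map_zero])
    have hmem : ρ h ∈ I • (⊤ : Submodule R (M →ₗ[A] Q)) := by
      refine hM.inj I hI _ fun m => ?_
      have := hh (f m)
      rw [LinearMap.comp_apply, LinearMap.comp_apply, hπ0, map_zero, map_zero] at this
      exact (Submodule.Quotient.mk_eq_zero _).1 this.symm
    have hmem2 : σ (ρ h) ∈ I • (⊤ : Submodule R ((Fin k → Q) →ₗ[A] Q)) :=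
      Submodule.smul_top_le_comap_smul_top I σ hmem
    refine ⟨κ h, fun y => ?_⟩
    obtain ⟨v, rfl⟩ := hπ y
    refine (hh v).trans ?_
    change _ = Submodule.Quotient.mk ((h - σ (ρ h)) v)
    rw [← sub_eq_zero, ← Submodule.Quotient.mk_sub, Submodule.Quotient.mk_eq_zero, mem_idealMul]
    have : h v - (h - σ (ρ h)) v = LinearMap.applyₗ' R v (σ (ρ h)) := by simp
    rw [this]
    exact Submodule.smul_top_le_comap_smul_top I (LinearMap.applyₗ' R v) hmem2
  · intro I hI g hg
    have := hom_pi_inj hQ k I hI (ι g) (fun x => hg _)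
    rw [← hκι g]
    exact Submodule.smul_top_le_comap_smul_top I κ this

end Coker

section Final

variable {R : Type u} [CommRing R] {A : Type u} [Ring A] [Algebra R A]
variable {Q : Type u} [AddCommGroup Q] [Module R Q] [Module A Q] [IsScalarTower R A Q]
variable {M : Type u} [AddCommGroup M] [Module R M] [Module A M] [IsScalarTower R A M]

/-- reduction of a map to `Q^k` -/
noncomputable def fbar (I : Ideal R) {k : ℕ} (f : M →ₗ[A] (Fin k → Q)) :
    (M ⧸ idealMul R A I M) →ₗ[A] (Fin k → Q ⧸ idealMul R A I Q) :=
  Submodule.liftQ _ (LinearMap.pi fun j => (idealMul R A I Q).mkQ ∘ₗ LinearMap.proj j ∘ₗ f) (by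
    intro x hx
    rw [LinearMap.mem_ker]
    ext j
    exact (Submodule.Quotient.mk_eq_zero _).2 (map_idealMul' I (LinearMap.proj j ∘ₗ f) hx))

lemma fbar_mk (I : Ideal R) {k : ℕ} (f : M →ₗ[A] (Fin k → Q)) (x : M) (j : Fin k) :
    fbar I f (Submodule.Quotient.mk x) j = Submodule.Quotient.mk (f x j) := rfl

lemma approx_fbar (hM : Good R A Q M) (I : Ideal R) (hI : I.IsMaximal) {k : ℕ}
    (f : M →ₗ[A] (Fin k → Q)) (hf : Approx Q f) :
    Approx (Q ⧸ idealMul R A I Q) (fbar I f) := by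
  intro g
  obtain ⟨g', hg'⟩ := hM.surj I hI g
  obtain ⟨h, hh⟩ := hf g'
  refine ⟨∑ j : Fin k, (Submodule.mapQ (idealMul R A I Q) (idealMul R A I Q)
    (h ∘ₗ LinearMap.single A (fun _ : Fin k => Q) j)
    (fun x hx => map_idealMul' I _ hx)) ∘ₗ LinearMap.proj j, fun y => ?_⟩
  obtain ⟨x, rfl⟩ := Submodule.mkQ_surjective _ y
  refine Eq.trans ?_ (hg' x).symm
  rw [← hh]
  conv_rhs => rw [sum_single (A := A) k (f x), map_sum]
  rw [LinearMap.sum_apply]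
  change _ = Submodule.mkQ _ (∑ j, _)
  rw [map_sum]
  rfl

lemma qlift {Y : Type u} [AddCommGroup Y] [Module R Y] (p : Submodule A Q)
    (g : Q →ₗ[R] Y) (hg : ∀ x ∈ p, g x = 0) :
    ∃ g' : (Q ⧸ p) →ₗ[R] Y, ∀ x, g' (Submodule.Quotient.mk x) = g x :=
  ⟨(Submodule.liftQ (p.restrictScalars R) g hg) ∘ₗ
    (Submodule.Quotient.restrictScalarsEquiv R p).symm.toLinearMap, fun _ => rfl⟩

lemma split_fbar (I : Ideal R) {k : ℕ} (f : M →ₗ[A] (Fin k → Q)) (hs : RSplitMono R A f) :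
    RSplitMono R A (fbar I f) := by
  obtain ⟨r, hr⟩ := (rsplit_iff f).1 hs
  rw [rsplit_iff]
  let π : M →ₗ[R] (M ⧸ idealMul R A I M) := (idealMul R A I M).mkQ.restrictScalars R
  choose ρ hρ using fun j : Fin k => qlift (idealMul R A I Q)
    (π ∘ₗ r ∘ₗ LinearMap.single R (fun _ : Fin k => Q) j) (by
      intro x hx
      exact (Submodule.Quotient.mk_eq_zero _).2
        (map_idealMul I (r ∘ₗ LinearMap.single R (fun _ : Fin k => Q) j) hx))
  refine ⟨∑ j : Fin k, ρ j ∘ₗ LinearMap.proj j, fun y => ?_⟩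
  obtain ⟨x, rfl⟩ := Submodule.mkQ_surjective _ y
  rw [LinearMap.sum_apply]
  have h1 : ∀ j, (ρ j ∘ₗ LinearMap.proj j) (fbar I f ((idealMul R A I M).mkQ x)) =
      (π ∘ₗ r) (LinearMap.single R (fun _ : Fin k => Q) j (f x j)) := fun j => hρ j (f x j)
  rw [Finset.sum_congr rfl fun j _ => h1 j, ← map_sum]
  have h2 : ∑ j : Fin k, LinearMap.single R (fun _ : Fin k => Q) j (f x j) = f x :=
    (sum_single (A := A) k (f x)).symm
  rw [h2, LinearMap.comp_apply, hr]
  rfl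

lemma split_of_fbar [IsNoetherianRing R] (hQ : Good R A Q Q) (hM : Good R A Q M) {k : ℕ}
    (f : M →ₗ[A] (Fin k → Q))
    (h : ∀ I : Ideal R, I.IsMaximal → Injective (fbar I f)) : RSplitMono R A f := by
  rw [rsplit_iff]
  have := hQ.proj
  have := pi_proj (R := R) k Q
  have := hM.fin
  have := hM.proj
  refine exists_retraction (f.restrictScalars R) fun I hI x hx => ?_
  rw [← mem_idealMul (A := A)] at hx ⊢
  rw [← Submodule.Quotient.mk_eq_zero]
  apply h I hI
  rw [map_zero]
  ext j
  rw [fbar_mk]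
  exact (Submodule.Quotient.mk_eq_zero _).2 ((mem_idealMul_pi I k _).1 hx j)

lemma coker_equiv (I : Ideal R) {k : ℕ} (f : M →ₗ[A] (Fin k → Q)) :
    Nonempty ((((Fin k → Q) ⧸ LinearMap.range f) ⧸
        idealMul R A I ((Fin k → Q) ⧸ LinearMap.range f)) ≃ₗ[A]
      ((Fin k → Q ⧸ idealMul R A I Q) ⧸ LinearMap.range (fbar I f))) := by
  let π : (Fin k → Q) →ₗ[A] (Fin k → Q ⧸ idealMul R A I Q) :=
    LinearMap.pi fun j => (idealMul R A I Q).mkQ ∘ₗ LinearMap.proj j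
  refine equiv_of_ker (Submodule.mkQ _ ∘ₗ (LinearMap.range f).mkQ)
    ((LinearMap.range (fbar I f)).mkQ ∘ₗ π)
    ((Submodule.mkQ_surjective _).comp (Submodule.mkQ_surjective _))
    ((Submodule.mkQ_surjective _).comp ?_) ?_
  · intro w
    choose v hv using fun j => Submodule.mkQ_surjective (idealMul R A I Q) (w j)
    exact ⟨v, funext hv⟩
  · intro v
    have e1 : (Submodule.mkQ (idealMul R A I ((Fin k → Q) ⧸ LinearMap.range f)) ∘ₗ
        (LinearMap.range f).mkQ) v = 0 ↔ (LinearMap.range f).mkQ v ∈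
          idealMul R A I ((Fin k → Q) ⧸ LinearMap.range f) :=
      Submodule.Quotient.mk_eq_zero _
    have e2 : ((LinearMap.range (fbar I f)).mkQ ∘ₗ π) v = 0 ↔ π v ∈ LinearMap.range (fbar I f) :=
      Submodule.Quotient.mk_eq_zero _
    rw [e1, e2]
    constructor
    · intro h
      rw [mem_idealMul] at h
      let p : (Fin k → Q) →ₗ[R] ((Fin k → Q) ⧸ LinearMap.range f) :=
        (LinearMap.range f).mkQ.restrictScalars R
      have hp : Surjective p := Submodule.mkQ_surjective (LinearMap.range f)
      rw [← LinearMap.range_eq_top.2 hp, LinearMap.range_eq_map p, ← Submodule.map_smul''] at h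
      obtain ⟨w, hw, hwv⟩ := h
      have hw' := (mem_idealMul_pi I k w).1 ((mem_idealMul (A := A) I w).2 hw)
      have : v - w ∈ LinearMap.range f := by
        rw [← Submodule.Quotient.mk_eq_zero, Submodule.Quotient.mk_sub, sub_eq_zero]
        exact hwv.symm
      obtain ⟨m, hm⟩ := this
      refine ⟨Submodule.Quotient.mk m, ?_⟩
      ext j
      rw [fbar_mk, hm]
      change Submodule.Quotient.mk (v j - w j) = Submodule.Quotient.mk (v j)
      rw [Submodule.Quotient.mk_sub, sub_eq_self, Submodule.Quotient.mk_eq_zero]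
      exact hw' j
    · rintro ⟨y, hy⟩
      obtain ⟨m, rfl⟩ := Submodule.mkQ_surjective _ y
      have h1 : v - f m ∈ idealMul R A I (Fin k → Q) := by
        rw [mem_idealMul_pi]
        intro j
        have := congrFun hy j
        rw [Pi.sub_apply, ← Submodule.Quotient.mk_eq_zero, Submodule.Quotient.mk_sub, sub_eq_zero]
        exact this.symm
      have h2 := map_idealMul' I (LinearMap.range f).mkQ h1
      rw [map_sub] at h2
      have h3 : (LinearMap.range f).mkQ (f m) = 0 := by simp
      rwa [h3, sub_zero] at h2

lemma exists_approx [IsNoetherianRing R] (hQ : Good R A Q Q) (hM : Good R A Q M) :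
    ∃ (k : ℕ) (f : M →ₗ[A] (Fin k → Q)), Approx Q f := by
  have := hQ.fin
  have := hM.fin
  have : Module.Finite R (M →ₗ[A] Q) :=
    Module.Finite.of_injective (LinearMap.restrictScalarsₗ R A M Q R)
      (LinearMap.restrictScalars_injective R)
  obtain ⟨k, p, hp⟩ := Module.Finite.exists_fin' R (M →ₗ[A] Q)
  refine ⟨k, LinearMap.pi fun j => p (Pi.single j 1), fun g => ?_⟩
  obtain ⟨c, rfl⟩ := hp g
  refine ⟨∑ j : Fin k, c j • LinearMap.proj j, fun m => ?_⟩
  have h2 : c = ∑ j : Fin k, (c j) • (Pi.single j (1 : R) : Fin k → R) := by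
    ext l; simp [Finset.sum_apply, Pi.single_apply]
  conv_rhs => rw [h2, map_sum]
  simp [LinearMap.sum_apply]

lemma main [IsNoetherianRing R] (hQ : Good R A Q Q) (n : ℕ) :
    ∀ (M : Type u) [AddCommGroup M] [Module R M] [Module A M] [IsScalarTower R A M],
      Good R A Q M → (DomdimGE R A Q n (ModuleCat.of A M) ↔ ∀ I : Ideal R, I.IsMaximal →
        DomdimGE R A (Q ⧸ idealMul R A I Q) n (ModuleCat.of A (M ⧸ idealMul R A I M))) := by
  induction n with
  | zero => intro M _ _ _ _ _; exact ⟨fun _ _ _ => trivial, fun _ => trivial⟩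
  | succ n ih =>
    intro M _ _ _ _ hM
    obtain ⟨k, f, hf⟩ := exists_approx hQ hM
    have hb : ∀ I : Ideal R, I.IsMaximal →
        (DomdimGE R A (Q ⧸ idealMul R A I Q) (n + 1) (ModuleCat.of A (M ⧸ idealMul R A I M)) ↔
        RSplitMono R A (fbar I f) ∧ DomdimGE R A (Q ⧸ idealMul R A I Q) n
          (ModuleCat.of A (((Fin k → Q) ⧸ LinearMap.range f) ⧸
            idealMul R A I ((Fin k → Q) ⧸ LinearMap.range f)))) := by
      intro I hI
      rw [domdimGE_succ_iff n (inAdd_pi k) (fbar I f) (approx_fbar hM I hI f hf)]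
      obtain ⟨e⟩ := coker_equiv I f
      rw [domdimGE_congr_iff n e]
    rw [domdimGE_succ_iff n (inAdd_pi k) f hf]
    constructor
    · rintro ⟨hs, hc⟩ I hI
      rw [hb I hI]
      exact ⟨split_fbar I f hs, (ih _ (good_coker hQ hM k f hf hs)).1 hc I hI⟩
    · intro h
      have hs : RSplitMono R A f :=
        split_of_fbar hQ hM f fun I hI => ((hb I hI).1 (h I hI)).1.1
      exact ⟨hs, (ih _ (good_coker hQ hM k f hf hs)).2 fun I hI => ((hb I hI).1 (h I hI)).2⟩

end Final

end RelDomAux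

section Stmt15

variable (R : Type u) [CommRing R] [IsNoetherianRing R]
variable (A : Type u) [Ring A] [Algebra R A] [Module.Finite R A] [Module.Projective R A]
variable (Q : Type u) [AddCommGroup Q] [Module R Q] [Module A Q]
  [IsScalarTower R A Q] [SMulCommClass A R Q] [SMulCommClass R A Q]
  [Module.Finite A Q] [Module.Projective R Q]
variable (M : Type u) [AddCommGroup M] [Module R M] [Module A M]
  [IsScalarTower R A M] [SMulCommClass A R M] [SMulCommClass R A M]
  [Module.Finite A M] [Module.Projective R M]

/-- Under the stated hypotheses (in particular that the canonical
map `R(𝔪) ⊗ Hom_A(M,Q) → Hom_{A(𝔪)}(M(𝔪), Q(𝔪))` is an isomorphism for every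
maximal ideal `𝔪` of `R`), the relative dominant dimension of `M` with respect to
`Q` is the infimum over all maximal ideals `𝔪` of the relative dominant dimensions
of `M(𝔪)` with respect to `Q(𝔪)` (where `X(𝔪) = R/𝔪 ⊗_R X` is realized as
`X ⧸ 𝔪X`, a module over `A(𝔪) = A/𝔪A`; `A(𝔪)`-modules are the same as
`A`-modules killed by `𝔪`). -/
theorem stmt_15
    (hDQQ : Module.Projective R (TensorOver R A (Q →ₗ[R] R) Q))
    (hDQM : Module.Projective R (TensorOver R A (Q →ₗ[R] R) M))
    (hHomProj : Module.Projective R (M →ₗ[A] Q))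
    (hcan : ∀ (I : Ideal R), I.IsMaximal →
      (Surjective (redMap R A Q M I) ∧
        ∀ g : M →ₗ[A] Q, redMap R A Q M I g = 0 ↔
          g ∈ I • (⊤ : Submodule R (M →ₗ[A] Q)))) :
    Domdim R A Q (ModuleCat.of A M) =
      ⨅ I : MaximalSpectrum R,
        Domdim R A ((Q : Type u) ⧸ idealMul R A I.asIdeal Q)
          (ModuleCat.of A ((M : Type u) ⧸ idealMul R A I.asIdeal M)) := by
  have hQf : Module.Finite R Q := Module.Finite.trans A Q
  have hMf : Module.Finite R M := Module.Finite.trans A M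
  have hQ : RelDomAux.Good R A Q Q := RelDomAux.good_self hDQQ
  have hM : RelDomAux.Good R A Q M := by
    refine ⟨hMf, inferInstance, hHomProj, ?_, ?_⟩
    · intro I hI g
      obtain ⟨g', rfl⟩ := (hcan I hI).1 g
      exact ⟨g', fun x => rfl⟩
    · intro I hI g hg
      refine ((hcan I hI).2 g).1 ?_
      apply Submodule.linearMap_qext
      refine LinearMap.ext fun x => ?_
      exact (Submodule.Quotient.mk_eq_zero _).2 (hg x)
  refine ENat.eq_of_forall_natCast_le_iff fun n => ?_
  rw [le_iInf_iff, RelDomAux.le_domdim_iff, RelDomAux.main hQ n M hM]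
  constructor
  · intro h I
    rw [RelDomAux.le_domdim_iff]
    exact h I.asIdeal I.isMaximal
  · intro h I hI
    have := h ⟨I, hI⟩
    rwa [RelDomAux.le_domdim_iff] at this

end Stmt15
end
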